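/- arXiv:1310.2339 — 2 statements merged into one kernel-verified Lean document; each statement's English description precedes it below -/
import Mathlib

section
/- Suppose a = 0 and b > 0. Then there exists a random variable C whose distribution is Gaussian with strictly positive variance such that, almost surely, lim_{t→∞} X(t) / ( t^{−1/4} e^{2√(bt)} ) = C; moreover lim_{t→∞} E[X(t)] / ( t^{−1/4} e^{2√(bt)} ) = E[C] and lim_{t→∞} Var[X(t)] / ( t^{−1/2} e^{4√(bt)} ) = Var[C]. -/
open MeasureTheory ProbabilityTheory Filter Real Set

noncomputable section

/-- `B` is a standard one-dimensional Brownian motion adapted to the filtration `F`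
under the probability measure `P`: all paths are continuous and start at `0`, the
increment `B t - B s` is Gaussian with mean `0` and variance `t - s`, and increments
after time `s` are independent of `F s`. -/
def IsStdBrownian {Ω : Type*} {mΩ : MeasurableSpace Ω} (P : Measure Ω)
    (F : MeasureTheory.Filtration ℝ mΩ) (B : ℝ → Ω → ℝ) : Prop :=
  MeasureTheory.Adapted F B ∧
  (∀ ω, B 0 ω = 0) ∧
  (∀ ω, Continuous fun t => B t ω) ∧
  (∀ s t : ℝ, 0 ≤ s → s ≤ t →
    P.map (fun ω => B t ω - B s ω) = gaussianReal 0 (Real.toNNReal (t - s))) ∧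
  (∀ s t : ℝ, 0 ≤ s → s ≤ t →
    Indep (MeasurableSpace.comap (fun ω => B t ω - B s ω) Real.measurableSpace) (F s) P)

/-- `X` is the (continuous, adapted) solution of the affine stochastic functional
differential equation `dX(t) = (a X(t) + b/(1+t) ∫_{-1}^t X(s) ds) dt + σ dB(t)` for
`t ≥ 0`, with initial history `ψ` on `[-1, 0]`; i.e. almost surely, for all `t ≥ 0`,
`X t = ψ 0 + ∫_0^t (a X(s) + b/(1+s) (∫_{-1}^0 ψ(u) du + ∫_0^s X(u) du)) ds + σ B t`. -/
def IsSolutionSFDE {Ω : Type*} {mΩ : MeasurableSpace Ω} (P : Measure Ω)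
    (F : MeasureTheory.Filtration ℝ mΩ) (a b σ : ℝ) (ψ : ℝ → ℝ)
    (B X : ℝ → Ω → ℝ) : Prop :=
  (∀ t : ℝ, 0 ≤ t → StronglyMeasurable[F t] (X t)) ∧
  (∀ ω, ContinuousOn (fun t => X t ω) (Set.Ici (0 : ℝ))) ∧
  (∀ᵐ ω ∂P, ∀ t : ℝ, 0 ≤ t →
    X t ω = ψ 0
      + (∫ s in (0:ℝ)..t,
          (a * X s ω + b / (1 + s) * ((∫ u in (-1:ℝ)..(0:ℝ), ψ u) + ∫ u in (0:ℝ)..s, X u ω)))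
      + σ * B t ω)

lemma integrableOn_laplace {w : ℝ → ℝ} {K : ℝ} (hw : Measurable w)
    (hK : ∀ s, 0 < s → |w s| ≤ K) {x : ℝ} (hx : 0 < x) :
    IntegrableOn (fun s => w s * exp (-(x * s))) (Ioi 0) := by
  have h := (exp_neg_integrableOn_Ioi 0 hx).const_mul K
  refine Integrable.mono' h (by fun_prop) ?_
  filter_upwards [ae_restrict_mem measurableSet_Ioi] with s hs
  rw [norm_mul, Real.norm_eq_abs, Real.norm_eq_abs, abs_of_pos (exp_pos _), neg_mul]
  exact mul_le_mul_of_nonneg_right (hK s hs) (exp_pos _).le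

lemma hasDerivAt_laplace {w : ℝ → ℝ} {K : ℝ} (hw : Measurable w)
    (hK : ∀ s, 0 < s → |w s| ≤ K) {x : ℝ} (hx : 0 < x) :
    HasDerivAt (fun y => ∫ s in Ioi (0:ℝ), w s * exp (-(y * s)))
      (-∫ s in Ioi (0:ℝ), s * w s * exp (-(x * s))) x := by
  have hK0 : 0 ≤ K := (abs_nonneg _).trans (hK 1 one_pos)
  have key := hasDerivAt_integral_of_dominated_loc_of_deriv_le (μ := volume.restrict (Ioi (0:ℝ)))
    (F := fun y s => w s * exp (-(y * s))) (F' := fun y s => -(s * w s * exp (-(y * s))))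
    (x₀ := x) (s := Ioi (x / 2)) (bound := fun s => K * (4 / x) * exp (-(x / 4) * s))
    (Ioi_mem_nhds (by linarith)) (Eventually.of_forall fun y => by fun_prop)
    (integrableOn_laplace hw hK hx) (by fun_prop) ?_
    ((exp_neg_integrableOn_Ioi 0 (by positivity)).const_mul _) ?_
  · simpa only [integral_neg] using key.2
  · filter_upwards [ae_restrict_mem measurableSet_Ioi] with s hs y hy
    have hs0 : (0:ℝ) < s := hs
    have hy' : x / 2 < y := hy
    rw [norm_neg, norm_mul, norm_mul, Real.norm_eq_abs, Real.norm_eq_abs, Real.norm_eq_abs,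
      abs_of_pos (exp_pos _), abs_of_pos hs0]
    have h1 : s ≤ 4 / x * exp (x / 4 * s) := by
      have := add_one_le_exp (x / 4 * s)
      calc s = 4 / x * (x / 4 * s) := by field_simp
        _ ≤ _ := by gcongr; linarith
    have h2 : exp (-(y * s)) ≤ exp (-(x / 2 * s)) := by
      apply exp_le_exp.2; nlinarith
    calc s * |w s| * exp (-(y * s)) ≤ (4 / x * exp (x / 4 * s)) * K * exp (-(x / 2 * s)) := by
          gcongr; exact hK s hs0
      _ = K * (4 / x) * (exp (x / 4 * s) * exp (-(x / 2 * s))) := by ring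
      _ = _ := by rw [← exp_add]; congr 2; ring
  · filter_upwards with s y hy
    have := (((hasDerivAt_id y).mul_const s).fun_neg.exp).const_mul (w s)
    simp only [id] at this
    exact this.congr_deriv (by ring)

lemma integral_laplace_pos {w : ℝ → ℝ} {K : ℝ} (hw : Measurable w)
    (hK : ∀ s, 0 < s → |w s| ≤ K) (hpos : ∀ s, 0 < s → 0 < w s) {x : ℝ} (hx : 0 < x) :
    0 < ∫ s in Ioi (0:ℝ), w s * exp (-(x * s)) := by
  rw [setIntegral_pos_iff_support_of_nonneg_ae _ (integrableOn_laplace hw hK hx)]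
  · have : Function.support (fun s => w s * exp (-(x * s))) ∩ Ioi 0 = Ioi 0 := by
      ext s
      simp only [mem_inter_iff, Function.mem_support, mem_Ioi, and_iff_right_iff_imp]
      intro hs
      exact (mul_pos (hpos s hs) (exp_pos _)).ne'
    rw [this]; simp
  · filter_upwards [ae_restrict_mem measurableSet_Ioi] with s hs
    exact (mul_pos (hpos s hs) (exp_pos _)).le

/-- The equation `p'' = (b / x) p` has a positive decreasing convex solution on `(0, ∞)`. -/
lemma exists_decreasing_solution {b : ℝ} (hb : 0 < b) :
    ∃ p q : ℝ → ℝ, ∀ x, 0 < x → HasDerivAt p (-q x) x ∧ HasDerivAt q (-(b / x * p x)) x ∧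
      0 < p x ∧ 0 < q x := by
  have hm0 : Measurable fun s : ℝ => s⁻¹ ^ 2 * exp (-(b * s⁻¹)) := by fun_prop
  have hm1 : Measurable fun s : ℝ => s⁻¹ * exp (-(b * s⁻¹)) := by fun_prop
  have hm2 : Measurable fun s : ℝ => exp (-(b * s⁻¹)) := by fun_prop
  have hK0 : ∀ s : ℝ, 0 < s → |s⁻¹ ^ 2 * exp (-(b * s⁻¹))| ≤ 2 / b ^ 2 := by
    intro s hs
    rw [abs_of_pos (by positivity), exp_neg, ← div_eq_mul_inv, div_le_div_iff₀ (exp_pos _) (by positivity)]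
    have := quadratic_le_exp_of_nonneg (x := b * s⁻¹) (by positivity)
    have h0 : 0 ≤ b * s⁻¹ := by positivity
    nlinarith
  have hK1 : ∀ s : ℝ, 0 < s → |s⁻¹ * exp (-(b * s⁻¹))| ≤ 1 / b := by
    intro s hs
    rw [abs_of_pos (by positivity), exp_neg, ← div_eq_mul_inv, div_le_div_iff₀ (exp_pos _) hb]
    have := add_one_le_exp (b * s⁻¹)
    linarith
  have hK2 : ∀ s : ℝ, 0 < s → |exp (-(b * s⁻¹))| ≤ 1 := by
    intro s hs
    rw [abs_of_pos (by positivity), exp_le_one_iff]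
    have : 0 < b * s⁻¹ := by positivity
    linarith
  refine ⟨fun x => ∫ s in Ioi (0:ℝ), s⁻¹ ^ 2 * exp (-(b * s⁻¹)) * exp (-(x * s)),
    fun x => ∫ s in Ioi (0:ℝ), s⁻¹ * exp (-(b * s⁻¹)) * exp (-(x * s)), fun x hx =>
    ⟨?_, ?_, integral_laplace_pos hm0 hK0 (fun s hs => by positivity) hx,
      integral_laplace_pos hm1 hK1 (fun s hs => by positivity) hx⟩⟩
  · convert! hasDerivAt_laplace hm0 hK0 hx using 2
    refine setIntegral_congr_fun measurableSet_Ioi fun s hs => ?_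
    have : s ≠ 0 := (mem_Ioi.1 hs).ne'
    field_simp
  · convert! hasDerivAt_laplace hm1 hK1 hx using 2
    have h2 : ∫ s in Ioi (0:ℝ), s * (s⁻¹ * exp (-(b * s⁻¹))) * exp (-(x * s))
        = ∫ s in Ioi (0:ℝ), exp (-(b * s⁻¹)) * exp (-(x * s)) := by
      refine setIntegral_congr_fun measurableSet_Ioi fun s hs => ?_
      have : s ≠ 0 := (mem_Ioi.1 hs).ne'
      field_simp
    rw [h2]
    set f : ℝ → ℝ := fun s => exp (-(b * s⁻¹)) * exp (-(x * s)) with hf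
    have hder : ∀ s ∈ Ioi (0:ℝ), HasDerivAt (Function.update f 0 0)
        (b * (s⁻¹ ^ 2 * exp (-(b * s⁻¹)) * exp (-(x * s)))
          - x * (exp (-(b * s⁻¹)) * exp (-(x * s)))) s := by
      intro s hs
      have hs0 : s ≠ 0 := (mem_Ioi.1 hs).ne'
      have h1 : HasDerivAt f (b * (s⁻¹ ^ 2 * exp (-(b * s⁻¹)) * exp (-(x * s)))
          - x * (exp (-(b * s⁻¹)) * exp (-(x * s)))) s := by
        have := (((hasDerivAt_inv hs0).const_mul b).fun_neg.exp).fun_mul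
          (((hasDerivAt_id s).const_mul x).fun_neg.exp)
        refine this.congr_deriv ?_
        simp only [id]
        field_simp
        ring
      refine h1.congr_of_eventuallyEq ?_
      filter_upwards [isOpen_ne.mem_nhds hs0] with y hy
      exact Function.update_of_ne hy _ _
    have hi0 := (integrableOn_laplace hm0 hK0 hx).const_mul b
    have hi2 := (integrableOn_laplace hm2 hK2 hx).const_mul x
    have hcont : ContinuousWithinAt (Function.update f 0 0) (Ici 0) 0 := by
      rw [continuousWithinAt_update_same, Ici_sdiff_left]
      have hb1 : Tendsto (fun s : ℝ => exp (-(b * s⁻¹))) (nhdsWithin 0 (Ioi 0)) (nhds 0) :=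
        tendsto_exp_neg_atTop_nhds_zero.comp (tendsto_inv_nhdsGT_zero.const_mul_atTop hb)
      have hb2 : Tendsto (fun s : ℝ => exp (-(x * s))) (nhdsWithin 0 (Ioi 0))
          (nhds (exp (-(x * 0)))) :=
        (Continuous.tendsto (by fun_prop) _).mono_left nhdsWithin_le_nhds
      simpa using hb1.mul hb2
    have hlim : Tendsto (Function.update f 0 0) atTop (nhds 0) := by
      have h3 : Tendsto (fun s : ℝ => exp (-(x * s))) atTop (nhds 0) :=
        tendsto_exp_neg_atTop_nhds_zero.comp (tendsto_id.const_mul_atTop hx)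
      refine squeeze_zero_norm' ?_ h3
      filter_upwards [eventually_gt_atTop 0] with s hs
      rw [Function.update_of_ne hs.ne', Real.norm_eq_abs, abs_of_pos (by positivity)]
      have := hK2 s hs
      rw [abs_of_pos (exp_pos _)] at this
      exact mul_le_of_le_one_left (exp_pos _).le this
    have := integral_Ioi_of_hasDerivAt_of_tendsto hcont hder (hi0.sub hi2) hlim
    rw [integral_sub hi0 hi2, integral_const_mul, integral_const_mul, Function.update_self] at this
    rw [sub_zero, sub_eq_zero] at this
    rw [div_mul_eq_mul_div, this, mul_div_cancel_left₀ _ hx.ne']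

lemma monotoneOn_Ici_of_hasDerivAt_nonneg {f f' : ℝ → ℝ} {a : ℝ}
    (hf : ∀ x, a ≤ x → HasDerivAt f (f' x) x) (h : ∀ x, a ≤ x → 0 ≤ f' x) :
    MonotoneOn f (Ici a) := by
  refine monotoneOn_of_hasDerivWithinAt_nonneg (convex_Ici a)
    (fun x hx => (hf x hx).continuousAt.continuousWithinAt)
    (fun x hx => (hf x (interior_subset hx)).hasDerivWithinAt) fun x hx => h x (interior_subset hx)

lemma antitoneOn_Ici_of_hasDerivAt_nonpos {f f' : ℝ → ℝ} {a : ℝ}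
    (hf : ∀ x, a ≤ x → HasDerivAt f (f' x) x) (h : ∀ x, a ≤ x → f' x ≤ 0) :
    AntitoneOn f (Ici a) := by
  refine antitoneOn_of_hasDerivWithinAt_nonpos (convex_Ici a)
    (fun x hx => (hf x hx).continuousAt.continuousWithinAt)
    (fun x hx => (hf x (interior_subset hx)).hasDerivWithinAt) fun x hx => h x (interior_subset hx)

/-- The decaying Liouville–Green approximation for the equation `p'' = (β² / x) p`. -/
def decayWKB (β x : ℝ) : ℝ := exp (1 / 4 * log x - 2 * β * √x)

lemma decayWKB_pos (β x : ℝ) : 0 < decayWKB β x := exp_pos _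

lemma hasDerivAt_decayWKB (β : ℝ) {x : ℝ} (hx : 0 < x) :
    HasDerivAt (decayWKB β) (decayWKB β x * (1 / (4 * x) - β / √x)) x := by
  have := (((hasDerivAt_log hx.ne').const_mul (1 / 4)).fun_sub
    ((hasDerivAt_sqrt hx.ne').const_mul (2 * β))).exp
  refine this.congr_deriv ?_
  rw [decayWKB]
  have := (sqrt_pos.2 hx).ne'
  field_simp

lemma decayWKB_le {β : ℝ} (hβ : 0 < β) (n : ℕ) :
    ∃ K, ∀ x, 1 ≤ x → decayWKB β x ≤ K / x ^ n := by
  set m : ℝ := 2 * (1 / 4 + n)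
  have hm : 0 < m := by positivity
  refine ⟨exp (m * (-1 - log (2 * β / m))), fun x hx => ?_⟩
  have hx0 : 0 < x := by linarith
  have hs : 0 < √x := sqrt_pos.2 hx0
  rw [le_div_iff₀ (by positivity), decayWKB]
  have hxn : x ^ n = exp (n * log x) := by rw [exp_nat_mul, exp_log hx0]
  rw [hxn, ← exp_add, exp_le_exp]
  have h1 := log_le_sub_one_of_pos (x := 2 * β / m * √x) (by positivity)
  rw [log_mul (by positivity) hs.ne', log_sqrt hx0.le] at h1
  have h2 := mul_le_mul_of_nonneg_left h1 hm.le
  have h3 : m * (2 * β / m * √x - 1) = 2 * β * √x - m := by field_simp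
  rw [h3] at h2
  simp only [m] at h2 ⊢
  linarith

section
variable {b : ℝ} {p q : ℝ → ℝ}

lemma wronskian_bounds (hb : 0 < b)
    (h : ∀ x, 0 < x → HasDerivAt p (-q x) x ∧ HasDerivAt q (-(b / x * p x)) x ∧ 0 < p x ∧ 0 < q x)
    {x : ℝ} (hx : 1 ≤ x) :
    -(3 / (32 * √b) / (x * √x)) * p x ≤ -q x - (1 / (4 * x) - √b / √x) * p x ∧
      -q x - (1 / (4 * x) - √b / √x) * p x ≤ 0 := by
  set β := √b with hβ
  have hβ0 : 0 < β := sqrt_pos.2 hb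
  have hbβ : b = β ^ 2 := (sq_sqrt hb.le).symm
  set g := decayWKB β with hg
  set k := 3 / (32 * β) with hk
  have hk0 : 0 < k := by positivity
  set W : ℝ → ℝ := fun x => g x * (-q x - (1 / (4 * x) - β / √x) * p x) with hW
  have hr : ∀ x : ℝ, 1 ≤ x → 0 < x ∧ 0 < √x ∧ √x ^ 2 = x := fun x hx =>
    ⟨by linarith, sqrt_pos.2 (by linarith), sq_sqrt (by linarith)⟩
  have hsq : ∀ x : ℝ, 1 ≤ x → HasDerivAt (fun x => 1 / (4 * x) - β / √x)
      (-(1 / (4 * x ^ 2)) + β / (2 * x * √x)) x := by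
    intro x hx
    obtain ⟨hx0, hs, hss⟩ := hr x hx
    have h1 := ((hasDerivAt_inv hx0.ne').const_mul (1 / 4)).fun_sub
      (((hasDerivAt_sqrt hx0.ne').fun_inv hs.ne').const_mul β)
    refine (h1.congr_deriv ?_).congr_of_eventuallyEq (Eventually.of_forall fun y => ?_)
    · rw [hss]; field_simp; ring
    · simp only [mul_inv, div_eq_mul_inv]
      ring
  have hWd : ∀ x, 1 ≤ x → HasDerivAt W (3 / (16 * x ^ 2) * g x * p x) x := by
    intro x hx
    obtain ⟨hx0, hs, hss⟩ := hr x hx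
    obtain ⟨hp, hq, -, -⟩ := h x hx0
    have h1 := (hasDerivAt_decayWKB β hx0).fun_mul (hq.fun_neg.fun_sub ((hsq x hx).fun_mul hp))
    refine h1.congr_deriv ?_
    rw [← hg, hbβ]
    have e : x = √x ^ 2 := hss.symm
    set r := √x
    rw [e]
    field_simp
    ring
  have hpanti : AntitoneOn p (Ici 1) := antitoneOn_Ici_of_hasDerivAt_nonpos
    (fun x hx => (h x (by linarith)).1) fun x hx => by linarith [(h x (by linarith)).2.2.2]
  have hqanti : AntitoneOn q (Ici 1) := antitoneOn_Ici_of_hasDerivAt_nonpos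
    (fun x hx => (h x (by linarith)).2.1) fun x hx => by
      have := (h x (by linarith)).2.2.1
      have : 0 < b / x * p x := mul_pos (div_pos hb (by linarith)) this
      linarith
  have hg0 : Tendsto g atTop (nhds 0) := by
    obtain ⟨K, hK⟩ := decayWKB_le hβ0 1
    refine squeeze_zero' (Eventually.of_forall fun x => (decayWKB_pos β x).le)
      ((eventually_ge_atTop 1).mono hK) ?_
    simpa using tendsto_const_nhds.div_atTop tendsto_id
  have hgp : Tendsto (fun x => g x * p x) atTop (nhds 0) := by
    refine squeeze_zero_norm' (a := fun x => g x * p 1) ?_ (by simpa using hg0.mul_const (p 1))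
    filter_upwards [eventually_ge_atTop 1] with x hx
    rw [norm_of_nonneg (mul_pos (decayWKB_pos β x) (h x (by linarith)).2.2.1).le]
    exact mul_le_mul_of_nonneg_left (hpanti self_mem_Ici hx hx) (decayWKB_pos β x).le
  have hgq : Tendsto (fun x => g x * q x) atTop (nhds 0) := by
    refine squeeze_zero_norm' (a := fun x => g x * q 1) ?_ (by simpa using hg0.mul_const (q 1))
    filter_upwards [eventually_ge_atTop 1] with x hx
    rw [norm_of_nonneg (mul_pos (decayWKB_pos β x) (h x (by linarith)).2.2.2).le]
    exact mul_le_mul_of_nonneg_left (hqanti self_mem_Ici hx hx) (decayWKB_pos β x).le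
  have hix : Tendsto (fun x : ℝ => x⁻¹) atTop (nhds 0) := tendsto_inv_atTop_zero
  have hir : Tendsto (fun x : ℝ => (√x)⁻¹) atTop (nhds 0) :=
    tendsto_inv_atTop_zero.comp tendsto_sqrt_atTop
  have hW0 : Tendsto W atTop (nhds 0) := by
    have := hgq.neg.sub (((hix.const_mul (1 / 4)).sub (hir.const_mul β)).mul hgp)
    simp only [neg_zero, mul_zero, sub_zero] at this
    refine this.congr fun x => ?_
    simp only [hW]
    ring
  have hWmono : MonotoneOn W (Ici 1) := monotoneOn_Ici_of_hasDerivAt_nonneg hWd fun x hx => by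
    have := (h x (by linarith)).2.2.1
    have := decayWKB_pos β x
    positivity
  have hWle : ∀ x, 1 ≤ x → W x ≤ 0 := fun x hx => ge_of_tendsto hW0 <| by
    filter_upwards [eventually_ge_atTop x] with y hy
    exact hWmono hx (hx.trans hy : (1:ℝ) ≤ y) hy
  set V : ℝ → ℝ := fun x => W x + k * (x * √x)⁻¹ * (g x * p x) with hV
  have hVd : ∀ x, 1 ≤ x → HasDerivAt V (3 / (16 * x ^ 2) * g x * p x
      + (k * (-(3 / (2 * x ^ 2 * √x))) * (g x * p x)
        + k * (x * √x)⁻¹ * (2 * (g x * (1 / (4 * x) - β / √x)) * p x + W x))) x := by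
    intro x hx
    obtain ⟨hx0, hs, hss⟩ := hr x hx
    obtain ⟨hp, hq, -, -⟩ := h x hx0
    have h1 := (((hasDerivAt_id x).fun_mul (hasDerivAt_sqrt hx0.ne')).fun_inv
      (mul_pos hx0 hs).ne').const_mul k
    have h2 := (hWd x hx).fun_add (h1.fun_mul ((hasDerivAt_decayWKB β hx0).fun_mul hp))
    refine h2.congr_deriv ?_
    simp only [← hg, hW, id]
    have e : x = √x ^ 2 := hss.symm
    set r := √x
    rw [e]
    field_simp
    ring
  have hVanti : AntitoneOn V (Ici 1) := antitoneOn_Ici_of_hasDerivAt_nonpos hVd fun x hx => by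
    obtain ⟨hx0, hs, hss⟩ := hr x hx
    have hp := (h x hx0).2.2.1
    have hgx : 0 < g x := decayWKB_pos β x
    have h1 : k * (x * √x)⁻¹ * W x ≤ 0 :=
      mul_nonpos_of_nonneg_of_nonpos (by positivity) (hWle x hx)
    have h2 : 3 / (16 * x ^ 2) * g x * p x
      + (k * (-(3 / (2 * x ^ 2 * √x))) * (g x * p x)
        + k * (x * √x)⁻¹ * (2 * (g x * (1 / (4 * x) - β / √x)) * p x))
        = - (k / (x ^ 2 * √x) * (g x * p x)) := by
      rw [hk]
      have e : x = √x ^ 2 := hss.symm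
      set r := √x
      rw [e]
      field_simp
      ring
    have h3 : 0 < k / (x ^ 2 * √x) * (g x * p x) := by positivity
    linarith
  have hV0 : Tendsto V atTop (nhds 0) := by
    have := hW0.add (((hix.mul hir).const_mul k).mul hgp)
    simp only [mul_zero, add_zero] at this
    refine this.congr fun x => ?_
    simp only [hV, mul_inv]
  have hVge : ∀ x, 1 ≤ x → 0 ≤ V x := fun x hx => le_of_tendsto hV0 <| by
    filter_upwards [eventually_ge_atTop x] with y hy
    exact hVanti hx (hx.trans hy : (1:ℝ) ≤ y) hy
  have hgx : 0 < g x := decayWKB_pos β x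
  refine ⟨?_, nonpos_of_mul_nonpos_right (hWle x hx) hgx⟩
  have := hVge x hx
  have h2 : V x = g x * ((-q x - (1 / (4 * x) - β / √x) * p x) + k / (x * √x) * p x) := by
    simp only [hV, hW]; ring
  rw [h2] at this
  have := nonneg_of_mul_nonneg_right this hgx
  linarith

lemma tendsto_div_decayWKB (hb : 0 < b)
    (h : ∀ x, 0 < x → HasDerivAt p (-q x) x ∧ HasDerivAt q (-(b / x * p x)) x ∧ 0 < p x ∧ 0 < q x) :
    ∃ c, 0 < c ∧ Tendsto (fun x => p x / decayWKB (√b) x) atTop (nhds c) ∧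
      ∀ x, 1 ≤ x → p x ≤ p 1 / decayWKB (√b) 1 * decayWKB (√b) x := by
  set β := √b with hβ
  have hβ0 : 0 < β := sqrt_pos.2 hb
  set g := decayWKB β with hg
  have hgpos : ∀ x, 0 < g x := decayWKB_pos β
  set k := 3 / (32 * β) with hk
  have hhd : ∀ x, 1 ≤ x → HasDerivAt (fun x => p x / g x)
      ((-q x - (1 / (4 * x) - β / √x) * p x) / g x) x := by
    intro x hx
    refine ((h x (by linarith)).1.fun_div (hasDerivAt_decayWKB β (by linarith))
      (hgpos x).ne').congr_deriv ?_
    have := (hgpos x).ne'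
    rw [← hg]
    field_simp
  have hanti := antitoneOn_Ici_of_hasDerivAt_nonpos hhd fun x hx =>
    div_nonpos_of_nonpos_of_nonneg (wronskian_bounds hb h hx).2 (hgpos x).le
  have hmono : MonotoneOn (fun x => p x / g x * exp (-(2 * k) * (√x)⁻¹)) (Ici 1) := by
    have hd : ∀ x : ℝ, 1 ≤ x → HasDerivAt (fun x => p x / g x * exp (-(2 * k) * (√x)⁻¹))
        (((-q x - (1 / (4 * x) - β / √x) * p x) / g x) * exp (-(2 * k) * (√x)⁻¹)
          + p x / g x * (exp (-(2 * k) * (√x)⁻¹) * (k / (x * √x)))) x := by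
      intro x hx
      have hx0 : 0 < x := by linarith
      have hs : 0 < √x := sqrt_pos.2 hx0
      have h1 := (((hasDerivAt_sqrt hx0.ne').fun_inv hs.ne').const_mul (-(2 * k))).exp
      refine ((hhd x hx).fun_mul h1).congr_deriv ?_
      rw [sq_sqrt hx0.le]
      congr 3
      field_simp
    refine monotoneOn_Ici_of_hasDerivAt_nonneg hd fun x hx => ?_
    have h1 := (wronskian_bounds hb h hx).1
    have h2 : ((-q x - (1 / (4 * x) - β / √x) * p x) / g x) * exp (-(2 * k) * (√x)⁻¹)
          + p x / g x * (exp (-(2 * k) * (√x)⁻¹) * (k / (x * √x)))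
        = exp (-(2 * k) * (√x)⁻¹) / g x *
          ((-q x - (1 / (4 * x) - β / √x) * p x) + k / (x * √x) * p x) := by ring
    rw [h2]
    exact mul_nonneg (div_pos (exp_pos _) (hgpos x)).le (by linarith)
  have h1 : 0 < p 1 / g 1 := div_pos (h 1 one_pos).2.2.1 (hgpos 1)
  have hlow : ∀ x, 1 ≤ x → p 1 / g 1 * exp (-(2 * k)) ≤ p x / g x := by
    intro x hx
    have := hmono self_mem_Ici hx hx
    simp only [sqrt_one, inv_one, mul_one] at this
    refine this.trans (mul_le_of_le_one_right
      (div_pos (h x (by linarith)).2.2.1 (hgpos x)).le (exp_le_one_iff.2 ?_))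
    have : 0 ≤ 2 * k * (√x)⁻¹ := by positivity
    linarith
  have hanti' : Antitone fun x => p (max x 1) / g (max x 1) := fun x y hxy =>
    hanti (le_max_right x 1 : (1:ℝ) ≤ _) (le_max_right y 1 : (1:ℝ) ≤ _) (max_le_max_right 1 hxy)
  have hlim := tendsto_atTop_ciInf hanti' ⟨p 1 / g 1 * exp (-(2 * k)), by
    rintro _ ⟨x, rfl⟩
    exact hlow _ (le_max_right x 1)⟩
  have hlim' : Tendsto (fun x => p x / g x) atTop
      (nhds (⨅ x, p (max x 1) / g (max x 1))) := by
    refine hlim.congr' ?_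
    filter_upwards [eventually_ge_atTop 1] with x hx
    rw [max_eq_left hx]
  refine ⟨_, (mul_pos h1 (exp_pos (-(2 * k)))).trans_le (ge_of_tendsto hlim' ?_), hlim', ?_⟩
  · filter_upwards [eventually_ge_atTop 1] with x hx using hlow x hx
  · intro x hx
    exact (div_le_iff₀ (hgpos x)).1 (hanti self_mem_Ici hx hx)

lemma exists_bound_mul_inv_pow (hb : 0 < b)
    (h : ∀ x, 0 < x → HasDerivAt p (-q x) x ∧ HasDerivAt q (-(b / x * p x)) x ∧ 0 < p x ∧ 0 < q x)
    (n : ℕ) : ∃ K, ∀ x, 1 ≤ x → p x ≤ K / x ^ n ∧ q x ≤ K / x ^ n := by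
  obtain ⟨c, -, -, hle⟩ := tendsto_div_decayWKB hb h
  obtain ⟨K, hK⟩ := decayWKB_le (sqrt_pos.2 hb) n
  have h1 : 0 < p 1 / decayWKB (√b) 1 := div_pos (h 1 one_pos).2.2.1 (decayWKB_pos _ _)
  have hp : ∀ x, 1 ≤ x → p x ≤ p 1 / decayWKB (√b) 1 * K / x ^ n := fun x hx => by
    rw [mul_div_assoc]
    exact (hle x hx).trans (mul_le_mul_of_nonneg_left (hK x hx) h1.le)
  set L := p 1 / decayWKB (√b) 1 * K
  set m := √b + 3 / (32 * √b)
  have hβ0 : 0 < √b := sqrt_pos.2 hb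
  have hm : 0 < m := by positivity
  have hL : 0 ≤ L := by
    have := hp 1 le_rfl
    simp only [one_pow, div_one] at this
    exact (h 1 one_pos).2.2.1.le.trans this
  refine ⟨(1 + m) * L, fun x hx => ?_⟩
  have hx0 : 0 < x := by linarith
  have hpx := (h x hx0).2.2.1
  have hx1 : 1 ≤ √x := one_le_sqrt.2 hx
  have hq : q x ≤ m * p x := by
    have h2 := (wronskian_bounds hb h hx).1
    have h3 : √b / √x ≤ √b := div_le_self hβ0.le hx1
    have h4 : 3 / (32 * √b) / (x * √x) ≤ 3 / (32 * √b) :=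
      div_le_self (by positivity) (one_le_mul_of_one_le_of_one_le hx hx1)
    have h5 : 0 < 1 / (4 * x) := by positivity
    have : q x ≤ (√b / √x - 1 / (4 * x) + 3 / (32 * √b) / (x * √x)) * p x := by linarith
    refine this.trans (mul_le_mul_of_nonneg_right ?_ hpx.le)
    simp only [m]
    linarith
  have hpx' := hp x hx
  have h0 : 0 ≤ L / x ^ n := by positivity
  rw [mul_div_assoc]
  constructor
  · nlinarith
  · nlinarith [mul_le_mul_of_nonneg_left hpx' hm.le]

lemma tendsto_logDeriv_sq (hb : 0 < b)
    (h : ∀ x, 0 < x → HasDerivAt p (-q x) x ∧ HasDerivAt q (-(b / x * p x)) x ∧ 0 < p x ∧ 0 < q x) :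
    Tendsto (fun x => b / x * (p x / q x) ^ 2) atTop (nhds 1) := by
  have hβ0 : 0 < √b := sqrt_pos.2 hb
  have hir : Tendsto (fun x : ℝ => (√x)⁻¹) atTop (nhds 0) :=
    tendsto_inv_atTop_zero.comp tendsto_sqrt_atTop
  have h1 : Tendsto (fun x => q x / p x * √x) atTop (nhds (√b)) := by
    have l1 : Tendsto (fun x : ℝ => √b - 1 / 4 * (√x)⁻¹) atTop (nhds (√b)) := by
      simpa only [mul_zero, sub_zero] using
        (tendsto_const_nhds (x := √b)).sub (hir.const_mul (1 / 4))
    have l2 : Tendsto (fun x : ℝ => √b - 1 / 4 * (√x)⁻¹ + 3 / (32 * √b) * (√x)⁻¹ ^ 2) atTop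
        (nhds (√b)) := by
      simpa using l1.add ((hir.pow 2).const_mul (3 / (32 * √b)))
    refine tendsto_of_tendsto_of_tendsto_of_le_of_le' l1 l2 ?_ ?_
    all_goals
      filter_upwards [eventually_ge_atTop 1] with x hx
      have hx0 : 0 < x := by linarith
      have hs : 0 < √x := sqrt_pos.2 hx0
      have hpx := (h x hx0).2.2.1
      obtain ⟨h2, h3⟩ := wronskian_bounds hb h hx
    · rw [div_mul_eq_mul_div (q x), le_div_iff₀ hpx]
      have h4 := mul_le_mul_of_nonneg_right h3 hs.le
      have e : (-q x - (1 / (4 * x) - √b / √x) * p x) * √x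
          = -(q x * √x) + (√b - 1 / 4 * (√x)⁻¹) * p x := by
        have e : x = √x ^ 2 := (sq_sqrt hx0.le).symm
        set r := √x
        rw [show 1 / (4 * x) = 1 / (4 * r ^ 2) by rw [e]]
        field_simp
        ring
      linarith
    · rw [div_mul_eq_mul_div (q x), div_le_iff₀ hpx]
      have h4 := mul_le_mul_of_nonneg_right h2 hs.le
      have e : (-q x - (1 / (4 * x) - √b / √x) * p x) * √x
          = -(q x * √x) + (√b - 1 / 4 * (√x)⁻¹) * p x := by
        have e : x = √x ^ 2 := (sq_sqrt hx0.le).symm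
        set r := √x
        rw [show 1 / (4 * x) = 1 / (4 * r ^ 2) by rw [e]]
        field_simp
        ring
      have e2 : -(3 / (32 * √b) / (x * √x)) * p x * √x
          = -(3 / (32 * √b) * (√x)⁻¹ ^ 2 * p x) := by
        rw [inv_pow, sq_sqrt hx0.le]
        field_simp
      linarith
  have h2 := ((h1.inv₀ hβ0.ne').pow 2).const_mul b
  have e : b * (√b)⁻¹ ^ 2 = 1 := by rw [inv_pow, sq_sqrt hb.le, mul_inv_cancel₀ hb.ne']
  rw [e] at h2
  refine h2.congr' ?_
  filter_upwards [eventually_gt_atTop 0] with x hx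
  rw [mul_inv, mul_pow, inv_div, inv_pow, sq_sqrt hx.le]
  ring

lemma tendsto_decayWKB_shift (hb : 0 < b) :
    Tendsto (fun t => decayWKB (√b) (1 + t) * (t ^ (-(1:ℝ) / 4) * exp (2 * √(b * t)))) atTop
      (nhds 1) := by
  have h1 : Tendsto (fun t : ℝ => log (1 + t⁻¹)) atTop (nhds 0) := by
    have : Tendsto (fun t : ℝ => 1 + t⁻¹) atTop (nhds (1 + 0)) :=
      tendsto_const_nhds.add tendsto_inv_atTop_zero
    rw [add_zero] at this
    simpa [Function.comp_def] using (continuousAt_log one_ne_zero).tendsto.comp this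
  have h2 : Tendsto (fun t : ℝ => √(1 + t) - √t) atTop (nhds 0) := by
    refine squeeze_zero' (g := fun t : ℝ => (√t)⁻¹) (Eventually.of_forall fun t => ?_) ?_
      (tendsto_inv_atTop_zero.comp tendsto_sqrt_atTop)
    · exact sub_nonneg.2 (sqrt_le_sqrt (by linarith))
    · filter_upwards [eventually_gt_atTop 0] with t ht
      have hs : 0 < √t := sqrt_pos.2 ht
      have h3 : √(1 + t) ≤ (√t)⁻¹ + √t := by
        rw [sqrt_le_left (by positivity)]
        have h4 : ((√t)⁻¹ + √t) ^ 2 = (√t)⁻¹ ^ 2 + 2 + √t ^ 2 := by field_simp; ring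
        rw [h4, sq_sqrt ht.le]
        nlinarith [sq_nonneg (√t)⁻¹]
      linarith
  have h3 : Tendsto (fun t : ℝ => exp (1 / 4 * log (1 + t⁻¹) - 2 * √b * (√(1 + t) - √t))) atTop
      (nhds 1) := by
    have := (continuous_exp.tendsto _).comp ((h1.const_mul (1 / 4)).sub (h2.const_mul (2 * √b)))
    simpa [Function.comp_def] using this
  refine h3.congr' ?_
  filter_upwards [eventually_gt_atTop 0] with t ht
  rw [decayWKB, rpow_def_of_pos ht, ← exp_add, ← exp_add, sqrt_mul hb.le]
  have : 1 + t = (1 + t⁻¹) * t := by field_simp; ring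
  congr 1
  rw [show log (1 + t) = log (1 + t⁻¹) + log t by rw [this, log_mul (by positivity) ht.ne']]
  ring
end

/-- A positive solution of `p'' = b / (1 + t) p` on `[0, ∞)`, with `q = -p'`, and its decay. -/
structure IsDecayingSolution (b : ℝ) (p q : ℝ → ℝ) (c K : ℝ) : Prop where
  hasDerivAt_p : ∀ t, 0 ≤ t → HasDerivAt p (-q t) t
  hasDerivAt_q : ∀ t, 0 ≤ t → HasDerivAt q (-(b / (1 + t) * p t)) t
  p_pos : ∀ t, 0 ≤ t → 0 < p t
  q_pos : ∀ t, 0 ≤ t → 0 < q t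
  p_le : ∀ t, 0 ≤ t → p t ≤ K / (1 + t) ^ 8
  q_le : ∀ t, 0 ≤ t → q t ≤ K / (1 + t) ^ 8
  c_pos : 0 < c
  tendsto_p : Tendsto (fun t => p t * (t ^ (-(1:ℝ) / 4) * exp (2 * √(b * t)))) atTop (nhds c)
  tendsto_ratio : Tendsto (fun t => b / (1 + t) * (p t / q t) ^ 2) atTop (nhds 1)

lemma exists_isDecayingSolution {b : ℝ} (hb : 0 < b) : ∃ p q c K, IsDecayingSolution b p q c K := by
  obtain ⟨p, q, h⟩ := exists_decreasing_solution hb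
  obtain ⟨c, hc, hlim, -⟩ := tendsto_div_decayWKB hb h
  obtain ⟨K, hK⟩ := exists_bound_mul_inv_pow hb h 8
  have hshift : Tendsto (fun t : ℝ => 1 + t) atTop atTop :=
    tendsto_atTop_add_const_left _ _ tendsto_id
  refine ⟨fun t => p (1 + t), fun t => q (1 + t), c, K, fun t ht => ?_, fun t ht => ?_,
    fun t ht => (h _ (by linarith)).2.2.1, fun t ht => (h _ (by linarith)).2.2.2,
    fun t ht => (hK _ (by linarith)).1, fun t ht => (hK _ (by linarith)).2, hc, ?_,
    (tendsto_logDeriv_sq hb h).comp hshift⟩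
  · exact (h _ (by linarith)).1.comp_const_add 1 t
  · exact (h _ (by linarith)).2.1.comp_const_add 1 t
  · have := (hlim.comp hshift).mul (tendsto_decayWKB_shift hb)
    rw [mul_one] at this
    refine this.congr fun t => ?_
    have := (decayWKB_pos (√b) (1 + t)).ne'
    simp only [Function.comp]
    field_simp

/-- L'Hôpital's rule at infinity in the `∞ / ∞` case. -/
lemma tendsto_div_of_tendsto_deriv_div {f g f' g' : ℝ → ℝ} {L : ℝ}
    (hf : ∀ t, 0 ≤ t → HasDerivAt f (f' t) t) (hg : ∀ t, 0 ≤ t → HasDerivAt g (g' t) t)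
    (hg' : ∀ t, 0 ≤ t → 0 < g' t) (hlim : Tendsto (fun t => f' t / g' t) atTop (nhds L))
    (hginf : Tendsto g atTop atTop) : Tendsto (fun t => f t / g t) atTop (nhds L) := by
  rw [Metric.tendsto_atTop]
  intro ε hε
  obtain ⟨T₀, hT₀⟩ := Metric.tendsto_atTop.1 hlim (ε / 2) (by positivity)
  set T := max T₀ 0
  have hT0 : 0 ≤ T := le_max_right _ _
  have hbd : ∀ t, T ≤ t → |f t - L * g t| ≤ |f T - L * g T| + ε / 2 * (g t - g T) := by
    intro t ht
    have := image_norm_le_of_norm_deriv_right_le_deriv_boundary' (a := T) (b := t)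
      (f := fun t => f t - L * g t) (f' := fun t => f' t - L * g' t)
      (B := fun t => |f T - L * g T| + ε / 2 * (g t - g T)) (B' := fun t => ε / 2 * g' t)
      (fun s hs => ((hf s (hT0.trans hs.1)).fun_sub ((hg s (hT0.trans hs.1)).const_mul L)
        ).continuousAt.continuousWithinAt)
      (fun s hs => ((hf s (hT0.trans hs.1)).fun_sub ((hg s (hT0.trans hs.1)).const_mul L)
        ).hasDerivWithinAt)
      (by simp)
      (fun s hs => ((((hg s (hT0.trans hs.1)).sub_const (g T)).const_mul (ε / 2)).const_add
        |f T - L * g T|).continuousAt.continuousWithinAt)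
      (fun s hs => ((((hg s (hT0.trans hs.1)).sub_const (g T)).const_mul (ε / 2)).const_add
        |f T - L * g T|).hasDerivWithinAt) ?_ (right_mem_Icc.2 ht)
    · simpa using this
    · intro s hs
      have h1 := hT₀ s ((le_max_left _ _).trans hs.1)
      have h2 := hg' s (hT0.trans hs.1)
      rw [Real.dist_eq] at h1
      have h3 : f' s - L * g' s = (f' s / g' s - L) * g' s := by field_simp
      rw [h3, norm_mul, Real.norm_eq_abs, norm_of_nonneg h2.le]
      exact mul_le_mul_of_nonneg_right h1.le h2.le
  obtain ⟨T₁, hT₁⟩ := eventually_atTop.1 <| hginf.eventually_gt_atTop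
    (max 0 ((|f T - L * g T| - ε / 2 * g T) * (2 / ε)))
  refine ⟨max T T₁, fun t ht => ?_⟩
  have h1 := hT₁ t ((le_max_right _ _).trans ht)
  have hg0 : 0 < g t := (le_max_left _ _).trans_lt h1
  have h2 := (le_max_right _ _).trans_lt h1
  have h3 := hbd t ((le_max_left _ _).trans ht)
  rw [Real.dist_eq, show f t / g t - L = (f t - L * g t) / g t by field_simp, abs_div,
    abs_of_pos hg0, div_lt_iff₀ hg0]
  have h4 := mul_lt_mul_of_pos_left h2 (show 0 < ε / 2 by positivity)
  have h5 : ε / 2 * ((|f T - L * g T| - ε / 2 * g T) * (2 / ε))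
    = |f T - L * g T| - ε / 2 * g T := by field_simp
  linarith

namespace IsDecayingSolution

variable {b c K : ℝ} {p q : ℝ → ℝ}

lemma antitoneOn_p (h : IsDecayingSolution b p q c K) : AntitoneOn p (Ici 0) :=
  antitoneOn_Ici_of_hasDerivAt_nonpos h.hasDerivAt_p fun x hx => by linarith [h.q_pos x hx]

lemma antitoneOn_q (h : IsDecayingSolution b p q c K) (hb : 0 < b) : AntitoneOn q (Ici 0) :=
  antitoneOn_Ici_of_hasDerivAt_nonpos h.hasDerivAt_q fun x hx => by
    have := h.p_pos x hx
    have : 0 < b / (1 + x) * p x := by positivity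
    linarith

lemma K_pos (h : IsDecayingSolution b p q c K) : 0 < K := by
  have := (h.p_pos 0 le_rfl).trans_le (h.p_le 0 le_rfl)
  simpa using this

lemma continuous_q_max (h : IsDecayingSolution b p q c K) :
    Continuous fun t => q (max t 0) :=
  continuous_iff_continuousAt.2 fun t =>
    ((h.hasDerivAt_q _ (le_max_right t 0)).continuousAt).comp_of_eq
      (by fun_prop : ContinuousAt (fun t : ℝ => max t 0) t) rfl

lemma hasDerivAt_inv_mul (h : IsDecayingSolution b p q c K) {t : ℝ} (ht : 0 ≤ t) :
    HasDerivAt (fun t => (p t * q t)⁻¹) ((1 + b / (1 + t) * (p t / q t) ^ 2) / p t ^ 2) t := by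
  have hp := (h.p_pos t ht).ne'
  have hq := (h.q_pos t ht).ne'
  refine (((h.hasDerivAt_p t ht).fun_mul (h.hasDerivAt_q t ht)).fun_inv
    (mul_ne_zero hp hq)).congr_deriv ?_
  field_simp
  ring

lemma tendsto_inv_mul_atTop (h : IsDecayingSolution b p q c K) (hb : 0 < b) :
    Tendsto (fun t => (p t * q t)⁻¹) atTop atTop := by
  refine Tendsto.inv_tendsto_nhdsGT_zero ?_
  rw [tendsto_nhdsWithin_iff]
  constructor
  · have hl : Tendsto (fun t : ℝ => K / (1 + t) ^ 8 * q 0) atTop (nhds 0) := by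
      have h1 : Tendsto (fun t : ℝ => (1 + t) ^ 8) atTop atTop :=
        (tendsto_pow_atTop (by norm_num)).comp (tendsto_atTop_add_const_left _ _ tendsto_id)
      simpa using (tendsto_const_nhds.div_atTop h1).mul_const (q 0)
    refine squeeze_zero' ?_ ?_ hl
    · filter_upwards [eventually_ge_atTop 0] with t ht
      exact (mul_pos (h.p_pos t ht) (h.q_pos t ht)).le
    · filter_upwards [eventually_ge_atTop 0] with t ht
      exact mul_le_mul (h.p_le t ht) (h.antitoneOn_q hb self_mem_Ici ht ht) (h.q_pos t ht).le
        ((h.p_pos t ht).le.trans (h.p_le t ht))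
  · filter_upwards [eventually_ge_atTop 0] with t ht
    exact mul_pos (h.p_pos t ht) (h.q_pos t ht)

end IsDecayingSolution

/-- A continuous path `x` solving the integral equation driven by the path `β`. -/
structure IsPathSolution (b σ x₀ Ψ : ℝ) (β x : ℝ → ℝ) : Prop where
  continuous_driver : Continuous β
  continuous_path : Continuous x
  eq : ∀ t, 0 ≤ t → x t = x₀ + (∫ s in (0:ℝ)..t, b / (1 + s) * (Ψ + ∫ u in (0:ℝ)..s, x u)) + σ * β t

namespace IsPathSolution

variable {b σ x₀ Ψ c K : ℝ} {β x p q : ℝ → ℝ}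

lemma hasDerivAt_primitive (hx : IsPathSolution b σ x₀ Ψ β x) (t : ℝ) :
    HasDerivAt (fun t => Ψ + ∫ u in (0:ℝ)..t, x u) (x t) t :=
  (hx.continuous_path.integral_hasStrictDerivAt 0 t).hasDerivAt.const_add Ψ

lemma exists_drift (hx : IsPathSolution b σ x₀ Ψ β x) :
    ∃ Z : ℝ → ℝ, Z 0 = x₀ ∧ (∀ t, 0 ≤ t → x t = Z t + σ * β t) ∧
      ∀ t, 0 ≤ t → HasDerivAt Z (b / (1 + t) * (Ψ + ∫ u in (0:ℝ)..t, x u)) t := by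
  have hc : Continuous fun s : ℝ => b / (1 + max s 0) * (Ψ + ∫ u in (0:ℝ)..s, x u) := by
    refine Continuous.mul ?_ (continuous_iff_continuousAt.2 fun t =>
      (hx.hasDerivAt_primitive t).continuousAt)
    refine continuous_const.div (by fun_prop) fun s => ?_
    have := le_max_right s 0
    positivity
  refine ⟨fun t => x₀ + ∫ s in (0:ℝ)..t, b / (1 + max s 0) * (Ψ + ∫ u in (0:ℝ)..s, x u),
    by simp, fun t ht => ?_, fun t ht => ?_⟩
  · rw [hx.eq t ht]
    congr 2
    refine intervalIntegral.integral_congr fun s hs => ?_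
    rw [uIcc_of_le ht] at hs
    simp only [max_eq_left hs.1]
  · have := (hc.integral_hasStrictDerivAt 0 t).hasDerivAt.const_add x₀
    rwa [max_eq_left ht] at this

/-- The conserved quantity `Z p + Y q`, where `Y` is the primitive and `x = Z + σ β`. -/
lemma wronskian_eq (hx : IsPathSolution b σ x₀ Ψ β x) (h : IsDecayingSolution b p q c K)
    {t : ℝ} (ht : 0 ≤ t) :
    x t * p t - σ * (β t * p t) + q t * (Ψ + ∫ u in (0:ℝ)..t, x u)
      = x₀ * p 0 + q 0 * Ψ + σ * ∫ s in (0:ℝ)..t, β s * q (max s 0) := by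
  obtain ⟨Z, hZ0, hZ, hZd⟩ := hx.exists_drift
  have hd : ∀ s ∈ uIcc 0 t, HasDerivAt
      (fun t => Z t * p t + q t * (Ψ + ∫ u in (0:ℝ)..t, x u)) (σ * (β s * q (max s 0))) s := by
    intro s hs
    rw [uIcc_of_le ht] at hs
    refine (((hZd s hs.1).fun_mul (h.hasDerivAt_p s hs.1)).fun_add
      ((h.hasDerivAt_q s hs.1).fun_mul (hx.hasDerivAt_primitive s))).congr_deriv ?_
    rw [max_eq_left hs.1, hZ s hs.1]
    ring
  have hint := intervalIntegral.integral_eq_sub_of_hasDerivAt hd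
    (((hx.continuous_driver.mul h.continuous_q_max).const_mul σ).intervalIntegrable 0 t)
  rw [intervalIntegral.integral_const_mul] at hint
  rw [hint, hZ t ht, intervalIntegral.integral_same, hZ0]
  ring

lemma hasDerivAt_primitive_div (hx : IsPathSolution b σ x₀ Ψ β x)
    (h : IsDecayingSolution b p q c K) {t : ℝ} (ht : 0 ≤ t) :
    HasDerivAt (fun t => (Ψ + ∫ u in (0:ℝ)..t, x u) / p t)
      ((x₀ * p 0 + q 0 * Ψ + σ * (∫ s in (0:ℝ)..t, β s * q (max s 0)) + σ * (β t * p t))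
        / p t ^ 2) t := by
  refine ((hx.hasDerivAt_primitive t).fun_div (h.hasDerivAt_p t ht)
    (h.p_pos t ht).ne').congr_deriv ?_
  rw [← hx.wronskian_eq h ht]
  ring

lemma tendsto_mul (hx : IsPathSolution b σ x₀ Ψ β x) (h : IsDecayingSolution b p q c K)
    (hb : 0 < b) (hβq : IntegrableOn (fun s => β s * q (max s 0)) (Ioi 0))
    (hβp : Tendsto (fun t => β t * p t) atTop (nhds 0)) :
    Tendsto (fun t => x t * p t - σ * (β t * p t)) atTop
      (nhds ((x₀ * p 0 + q 0 * Ψ + σ * ∫ s in Ioi (0:ℝ), β s * q (max s 0)) / 2)) := by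
  set L := x₀ * p 0 + q 0 * Ψ + σ * ∫ s in Ioi (0:ℝ), β s * q (max s 0)
  have hN : Tendsto (fun t => x₀ * p 0 + q 0 * Ψ + σ * ∫ s in (0:ℝ)..t, β s * q (max s 0)) atTop
      (nhds L) :=
    ((intervalIntegral_tendsto_integral_Ioi 0 hβq tendsto_id).const_mul σ).const_add _
  have hY : Tendsto (fun t => (Ψ + ∫ u in (0:ℝ)..t, x u) / p t / (p t * q t)⁻¹) atTop
      (nhds (L / 2)) := by
    refine tendsto_div_of_tendsto_deriv_div (fun t ht => hx.hasDerivAt_primitive_div h ht)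
      (fun t ht => h.hasDerivAt_inv_mul ht) (fun t ht => ?_) ?_ (h.tendsto_inv_mul_atTop hb)
    · have h1 := h.p_pos t ht
      have h2 := h.q_pos t ht
      positivity
    · have h1 := (hN.add (hβp.const_mul σ)).div (h.tendsto_ratio.const_add 1) (by norm_num)
      rw [mul_zero, add_zero, one_add_one_eq_two] at h1
      refine h1.congr' ?_
      filter_upwards [eventually_ge_atTop 0] with t ht
      have := (h.p_pos t ht).ne'
      simp only [Pi.div_apply]
      rw [div_div_div_cancel_right₀ (by positivity)]
  have := hN.sub hY
  rw [sub_half] at this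
  refine this.congr' ?_
  filter_upwards [eventually_ge_atTop 0] with t ht
  have h1 := (h.p_pos t ht).ne'
  have h2 := (h.q_pos t ht).ne'
  rw [← hx.wronskian_eq h ht]
  field_simp
  ring

lemma abs_mul_sub_le (hx : IsPathSolution b σ x₀ Ψ β x) (h : IsDecayingSolution b p q c K)
    (hb : 0 < b) {t : ℝ} (ht : 0 ≤ t) :
    |x t * p t - σ * (β t * p t)| ≤ 2 * |x₀ * p 0 + q 0 * Ψ| + q 0 * |Ψ|
      + 3 * |σ| * ∫ s in (0:ℝ)..t, |β s| * q (max s 0) := by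
  set N₀ := x₀ * p 0 + q 0 * Ψ with hN₀
  set J : ℝ → ℝ := fun t => ∫ s in (0:ℝ)..t, |β s| * q (max s 0) with hJ
  have hJd : ∀ t, HasDerivAt J (|β t| * q (max t 0)) t := fun t =>
    ((hx.continuous_driver.abs.mul h.continuous_q_max).integral_hasStrictDerivAt 0 t).hasDerivAt
  have hNle : ∀ s, 0 ≤ s → |N₀ + σ * ∫ u in (0:ℝ)..s, β u * q (max u 0)| ≤ |N₀| + |σ| * J s := by
    intro s hs
    refine (abs_add_le _ _).trans ?_
    rw [abs_mul]
    gcongr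
    refine (intervalIntegral.abs_integral_le_integral_abs hs).trans_eq ?_
    refine intervalIntegral.integral_congr fun u hu => ?_
    simp only [abs_mul, abs_of_pos (h.q_pos _ (le_max_right u 0))]
  have hJ0 : ∀ s, 0 ≤ s → 0 ≤ J s := fun s hs =>
    intervalIntegral.integral_nonneg hs fun u _ =>
      mul_nonneg (abs_nonneg _) (h.q_pos _ (le_max_right u 0)).le
  have hRd : ∀ s, 0 ≤ s → HasDerivAt
      (fun s => |Ψ| / p 0 + (|N₀| + 2 * |σ| * J s) * (p s * q s)⁻¹)
      (2 * |σ| * (|β s| * q (max s 0)) * (p s * q s)⁻¹ + (|N₀| + 2 * |σ| * J s) *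
        ((1 + b / (1 + s) * (p s / q s) ^ 2) / p s ^ 2)) s := fun s hs =>
    (((((hJd s).const_mul (2 * |σ|)).const_add |N₀|).fun_mul (h.hasDerivAt_inv_mul hs)).const_add _)
  have hY := image_norm_le_of_norm_deriv_right_le_deriv_boundary' (a := 0) (b := t)
    (fun s hs => (hx.hasDerivAt_primitive_div h hs.1).continuousAt.continuousWithinAt)
    (fun s hs => (hx.hasDerivAt_primitive_div h hs.1).hasDerivWithinAt) ?_
    (fun s hs => (hRd s hs.1).continuousAt.continuousWithinAt)
    (fun s hs => (hRd s hs.1).hasDerivWithinAt) ?_ (right_mem_Icc.2 ht)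
  · have hp := h.p_pos t ht
    have hq := h.q_pos t ht
    have h0 := h.p_pos 0 le_rfl
    have e : x t * p t - σ * (β t * p t) = (N₀ + σ * ∫ s in (0:ℝ)..t, β s * q (max s 0))
        - q t * p t * ((Ψ + ∫ u in (0:ℝ)..t, x u) / p t) := by
      rw [hN₀, ← hx.wronskian_eq h ht]; field_simp; ring
    rw [e]
    refine (abs_sub _ _).trans ?_
    rw [abs_mul, abs_of_pos (mul_pos hq hp)]
    have h1 := mul_le_mul_of_nonneg_left hY (mul_pos hq hp).le
    rw [Real.norm_eq_abs] at h1
    have h2 : q t * p t * (|Ψ| / p 0 + (|N₀| + 2 * |σ| * J t) * (p t * q t)⁻¹)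
        = q t * (p t / p 0) * |Ψ| + (|N₀| + 2 * |σ| * J t) := by field_simp
    have h3 : q t * (p t / p 0) ≤ q 0 := by
      have h4 : p t / p 0 ≤ 1 := (div_le_one h0).2 (h.antitoneOn_p self_mem_Ici ht ht)
      have h5 : q t ≤ q 0 := h.antitoneOn_q hb self_mem_Ici ht ht
      exact (mul_le_of_le_one_right hq.le h4).trans h5
    have h4 := mul_le_mul_of_nonneg_right h3 (abs_nonneg Ψ)
    have h5 := hNle t ht
    linarith
  · have hp := h.p_pos 0 le_rfl
    have hq := h.q_pos 0 le_rfl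
    simp only [intervalIntegral.integral_same, add_zero, norm_div, Real.norm_eq_abs,
      abs_of_pos hp, hJ, mul_zero]
    have : 0 ≤ |N₀| * (p 0 * q 0)⁻¹ := by positivity
    linarith
  · intro s hs
    have hp := h.p_pos s hs.1
    have hq := h.q_pos s hs.1
    have h1 := hNle s hs.1
    have h2 := hJ0 s hs.1
    have hs0 := hs.1
    rw [norm_div, Real.norm_eq_abs, norm_of_nonneg (by positivity), max_eq_left hs.1]
    have h3 : |N₀ + σ * (∫ u in (0:ℝ)..s, β u * q (max u 0)) + σ * (β s * p s)|
        ≤ |N₀| + 2 * |σ| * J s + 2 * |σ| * |β s| * p s := by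
      refine (abs_add_le _ _).trans ?_
      rw [abs_mul σ, abs_mul (β s), abs_of_pos hp]
      have : 0 ≤ |σ| * J s := by positivity
      have : 0 ≤ |σ| * (|β s| * p s) := by positivity
      linarith
    refine (div_le_div_of_nonneg_right h3 (by positivity)).trans ?_
    have h4 : 2 * |σ| * (|β s| * q s) * (p s * q s)⁻¹ = 2 * |σ| * |β s| * p s / p s ^ 2 := by
      field_simp
    have h5 : 0 ≤ b / (1 + s) * (p s / q s) ^ 2 := by positivity
    have h6 : |N₀| + 2 * |σ| * J s ≤ (|N₀| + 2 * |σ| * J s) * (1 + b / (1 + s) * (p s / q s) ^ 2) :=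
      le_mul_of_one_le_right (by positivity) (by linarith)
    have h7 := div_le_div_of_nonneg_right h6 (sq_nonneg (p s))
    rw [mul_div_assoc] at h7
    rw [h4, add_div]
    linarith

end IsPathSolution

namespace IsStdBrownian

variable {Ω : Type*} {mΩ : MeasurableSpace Ω} {P : Measure Ω}
  {F : MeasureTheory.Filtration ℝ mΩ} {B : ℝ → Ω → ℝ}

lemma measurable (hB : IsStdBrownian P F B) (t : ℝ) : Measurable (B t) :=
  (hB.1 t).mono (F.le t) le_rfl

lemma hasLaw (hB : IsStdBrownian P F B) {t : ℝ} (ht : 0 ≤ t) :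
    HasLaw (B t) (gaussianReal 0 t.toNNReal) P := by
  refine ⟨(hB.measurable t).aemeasurable, ?_⟩
  simpa [hB.2.1] using hB.2.2.2.1 0 t le_rfl ht

lemma memLp (hB : IsStdBrownian P F B) {t : ℝ} (ht : 0 ≤ t) : MemLp (B t) 2 P := by
  have h := memLp_id_gaussianReal' (μ := 0) (v := t.toNNReal) 2 (by simp)
  rw [← (hB.hasLaw ht).map_eq] at h
  exact h.comp_of_map (hB.measurable t).aemeasurable

lemma integral_eq_zero (hB : IsStdBrownian P F B) {t : ℝ} (ht : 0 ≤ t) : ∫ ω, B t ω ∂P = 0 := by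
  rw [(hB.hasLaw ht).integral_eq, integral_id_gaussianReal]

lemma integral_sq (hB : IsStdBrownian P F B) {t : ℝ} (ht : 0 ≤ t) : ∫ ω, B t ω ^ 2 ∂P = t := by
  have h := (hB.hasLaw ht).variance_eq
  rw [variance_id_gaussianReal, variance_of_integral_eq_zero (hB.measurable t).aemeasurable
    (hB.integral_eq_zero ht), Real.coe_toNNReal _ ht] at h
  exact h

variable [IsProbabilityMeasure P]

lemma integrable (hB : IsStdBrownian P F B) {t : ℝ} (ht : 0 ≤ t) : Integrable (B t) P :=
  (hB.memLp ht).integrable (by norm_num)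

lemma integral_abs_le (hB : IsStdBrownian P F B) {t : ℝ} (ht : 0 ≤ t) :
    ∫ ω, |B t ω| ∂P ≤ t + 1 := by
  calc ∫ ω, |B t ω| ∂P ≤ ∫ ω, (B t ω ^ 2 + 1) ∂P := by
        refine integral_mono (hB.integrable ht).abs
          ((hB.memLp ht).integrable_sq.add (integrable_const _)) fun ω => ?_
        have := sq_nonneg (|B t ω| - 1)
        have h2 := sq_abs (B t ω)
        have := abs_nonneg (B t ω)
        simp only
        nlinarith
    _ = t + 1 := by
        rw [integral_add (hB.memLp ht).integrable_sq (integrable_const _), hB.integral_sq ht]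
        simp

lemma condExp_eq (hB : IsStdBrownian P F B) {s t : ℝ} (hs : 0 ≤ s) (hst : s ≤ t) :
    P[B t | F s] =ᵐ[P] B s := by
  have h1 : P[fun ω => B t ω - B s ω | F s] =ᵐ[P] fun _ => ∫ ω, (B t ω - B s ω) ∂P :=
    condExp_indep_eq ((measurable_iff_comap_le.1
        ((hB.measurable t).sub (hB.measurable s)))) (F.le s)
      (Measurable.stronglyMeasurable (comap_measurable _)) (hB.2.2.2.2 s t hs hst)
  have h2 : P[B s | F s] = B s :=
    condExp_of_stronglyMeasurable (F.le s) (hB.1 s).stronglyMeasurable (hB.integrable hs)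
  have h3 := condExp_add (μ := P) (m := F s)
    ((hB.integrable (hs.trans hst)).sub (hB.integrable hs)) (hB.integrable hs)
  rw [sub_add_cancel] at h3
  filter_upwards [h1, h3] with ω h1 h3
  rw [h3, Pi.add_apply, h2]
  have h4 : P[B t - B s | F s] ω = ∫ ω, (B t ω - B s ω) ∂P := h1
  rw [h4, integral_sub (hB.integrable (hs.trans hst)) (hB.integrable hs),
    hB.integral_eq_zero (hs.trans hst), hB.integral_eq_zero hs]
  simp

lemma mul_measure_exists_abs_le (hB : IsStdBrownian P F B) {T : ℝ} (hT : 0 ≤ T) (ε : NNReal) :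
    ε * P {ω | ∃ t ∈ Icc 0 T, ε < |B t ω|} ≤ ENNReal.ofReal (T + 1) := by
  set E : ℕ → Set Ω := fun m => {ω | ∃ k ≤ m + 1, (ε : ℝ) ≤ |B (k * (T / (m + 1))) ω|}
  have hE : ∀ m, ε * P (E m) ≤ ENNReal.ofReal (T + 1) := by
    intro m
    set d := T / (m + 1)
    have hd : 0 ≤ d := by positivity
    have hmono : Monotone fun k : ℕ => (k : ℝ) * d := fun i j hij =>
      mul_le_mul_of_nonneg_right (Nat.cast_le.2 hij) hd
    set G : MeasureTheory.Filtration ℕ mΩ :=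
      ⟨fun k => F (k * d), fun i j hij => F.mono (hmono hij), fun k => F.le _⟩
    have hM : Martingale (fun (k : ℕ) => B (k * d)) G P :=
      ⟨fun k => (hB.1 _).stronglyMeasurable, fun i j hij =>
        hB.condExp_eq (by positivity) (hmono hij)⟩
    have hS : Submartingale (fun (k : ℕ) ω => |B (k * d) ω|) G P :=
      hM.submartingale.sup hM.neg.submartingale
    have h := maximal_ineq (ε := ε) hS (fun k ω => abs_nonneg _) (m + 1)
    have e : {ω | (ε : ℝ) ≤ (Finset.range (m + 1 + 1)).sup' Finset.nonempty_range_add_one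
        fun (k : ℕ) => |B (k * d) ω|} = E m := by
      ext ω
      simp only [Finset.le_sup'_iff, Finset.mem_range, E, mem_ofPred_eq, Nat.lt_succ_iff, d]
    rw [e] at h
    refine h.trans (ENNReal.ofReal_le_ofReal ?_)
    have hmT : ((m + 1 : ℕ) : ℝ) * d = T := by push_cast; simp only [d]; field_simp
    simp only [hmT]
    exact (setIntegral_le_integral (hB.integrable hT).abs
      (Eventually.of_forall fun ω => abs_nonneg _)).trans (hB.integral_abs_le hT)
  have hsub : {ω | ∃ t ∈ Icc 0 T, ε < |B t ω|} ⊆ ⋃ N, ⋂ m ≥ N, E m := by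
    rintro ω ⟨t, ht, hε⟩
    have hT0 : T ≠ 0 := by
      rintro rfl
      have : t = 0 := le_antisymm ht.2 ht.1
      rw [this, hB.2.1, abs_zero] at hε
      exact absurd hε (not_lt.2 ε.2)
    have h1 : Tendsto (fun m : ℕ => ((⌊t / T * ((m : ℝ) + 1)⌋₊ : ℝ)) / ((m : ℝ) + 1)) atTop
        (nhds (t / T)) := (tendsto_nat_floor_mul_div_atTop (div_nonneg ht.1 hT)).comp
      (tendsto_atTop_add_const_right _ _ tendsto_natCast_atTop_atTop)
    have h2 : Tendsto (fun m : ℕ => |B ((⌊t / T * ((m : ℝ) + 1)⌋₊ : ℝ) * (T / ((m : ℝ) + 1))) ω|)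
        atTop (nhds |B t ω|) := by
      refine (((hB.2.2.1 ω).abs.tendsto t).comp ?_)
      have h3 := h1.mul_const T
      rw [div_mul_cancel₀ _ hT0] at h3
      refine h3.congr fun m => ?_
      ring
    obtain ⟨N, hN⟩ := eventually_atTop.1 (h2.eventually (lt_mem_nhds hε))
    refine mem_iUnion.2 ⟨N, mem_iInter₂.2 fun m hm => ⟨_, ?_, (hN m hm).le⟩⟩
    refine Nat.floor_le_of_le ?_
    push_cast
    exact mul_le_of_le_one_left (by positivity) (div_le_one_of_le₀ ht.2 hT)
  refine (mul_le_mul_right (measure_mono hsub) _).trans ?_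
  rw [Monotone.measure_iUnion, ENNReal.mul_iSup]
  · exact iSup_le fun N => (mul_le_mul_right (measure_mono (iInter₂_subset N le_rfl)) _).trans (hE N)
  · exact fun i j hij => iInter₂_mono' fun m hm => ⟨m, hij.trans hm, Subset.rfl⟩

lemma ae_exists_abs_le (hB : IsStdBrownian P F B) :
    ∀ᵐ ω ∂P, ∃ M : ℝ, ∀ t, 0 ≤ t → |B t ω| ≤ M * (1 + t) ^ 3 := by
  have hsum : (∑' n : ℕ, P {ω | ∃ t ∈ Icc (0 : ℝ) n, (((n : NNReal) + 1) ^ 3 : NNReal) < |B t ω|})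
      ≠ ⊤ := by
    have h1 : ∀ n : ℕ, P {ω | ∃ t ∈ Icc (0 : ℝ) n, (((n : NNReal) + 1) ^ 3 : NNReal) < |B t ω|}
        ≤ ENNReal.ofReal (1 / ((n : ℝ) + 1) ^ 2) := by
      intro n
      have h := hB.mul_measure_exists_abs_le (T := n) (by positivity) (((n : NNReal) + 1) ^ 3)
      rw [mul_comm, ← ENNReal.le_div_iff_mul_le (by simp) (by simp)] at h
      refine h.trans (le_of_eq ?_)
      rw [← ENNReal.ofReal_coe_nnreal, ← ENNReal.ofReal_div_of_pos (by positivity)]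
      congr 1
      push_cast
      field_simp
    refine ne_top_of_le_ne_top ?_ (ENNReal.tsum_le_tsum h1)
    refine Summable.tsum_ofReal_ne_top ?_
    have := (summable_nat_add_iff 1).2 (Real.summable_one_div_nat_pow.2 one_lt_two)
    simpa using this
  filter_upwards [ae_eventually_notMem hsum] with ω hω
  obtain ⟨N, hN⟩ := eventually_atTop.1 hω
  simp only [not_exists, not_and, not_lt] at hN
  refine ⟨((N : ℝ) + 2) ^ 3, fun t ht => ?_⟩
  have h1 := hN (max N ⌈t⌉₊) (le_max_left _ _) t ⟨ht, (Nat.le_ceil t).trans (by simp)⟩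
  refine h1.trans ?_
  push_cast
  rw [← mul_pow]
  gcongr
  have h2 := Nat.ceil_lt_add_one ht
  have h3 : (0 : ℝ) ≤ N := by positivity
  have : max (N : ℝ) ⌈t⌉₊ ≤ N + ⌈t⌉₊ := max_le (by simp) (by simp)
  nlinarith

end IsStdBrownian

lemma exists_map_eq_gaussianReal_of_tendsto {Ω : Type*} {mΩ : MeasurableSpace Ω} {P : Measure Ω}
    [IsProbabilityMeasure P] {S : ℕ → Ω → ℝ} {Y : Ω → ℝ} (hY : AEMeasurable Y P)
    {v : ℕ → NNReal} {l u : NNReal} (hv : ∀ n, v n ∈ Icc l u)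
    (hS : ∀ n, HasLaw (S n) (gaussianReal 0 (v n)) P)
    (hlim : ∀ᵐ ω ∂P, Tendsto (fun n => S n ω) atTop (nhds (Y ω))) :
    ∃ w ∈ Icc l u, P.map Y = gaussianReal 0 w := by
  obtain ⟨w, hw, φ, hφ, hvφ⟩ := isCompact_Icc.tendsto_subseq hv
  refine ⟨w, hw, ?_⟩
  have := Measure.isProbabilityMeasure_map hY
  refine Measure.ext_of_charFun (funext fun θ => ?_)
  have h1 : Tendsto (fun n => charFun (P.map (S n)) θ) atTop (nhds (charFun (P.map Y) θ)) := by
    simp only [charFun_apply_real]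
    have e : ∀ Z : Ω → ℝ, AEMeasurable Z P → ∫ x, Complex.exp (θ * x * Complex.I) ∂(P.map Z)
        = ∫ ω, Complex.exp (θ * Z ω * Complex.I) ∂P := fun Z hZ =>
      integral_map hZ (by fun_prop)
    rw [e Y hY]
    simp only [e _ (hS _).aemeasurable]
    refine tendsto_integral_of_dominated_convergence (fun _ => 1) (fun n => ?_)
      (integrable_const _) (fun n => Eventually.of_forall fun ω => ?_) ?_
    · have := (hS n).aemeasurable
      exact (by fun_prop : AEMeasurable (fun ω => Complex.exp (θ * S n ω * Complex.I)) P).aestronglyMeasurable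
    · rw [← Complex.ofReal_mul, Complex.norm_exp_ofReal_mul_I]
    · filter_upwards [hlim] with ω hω
      exact (by fun_prop : Continuous fun x : ℝ => Complex.exp (θ * x * Complex.I)).tendsto _ |>.comp hω
  have h2 : Tendsto (fun n => charFun (P.map (S (φ n))) θ) atTop
      (nhds (charFun (gaussianReal 0 w) θ)) := by
    simp only [(hS _).map_eq, charFun_gaussianReal]
    have h3 : Continuous fun w : NNReal =>
        Complex.exp (θ * (0 : ℝ) * Complex.I - w * θ ^ 2 / 2) := by fun_prop
    exact (h3.tendsto w).comp hvφ
  exact tendsto_nhds_unique (h1.comp hφ.tendsto_atTop) h2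

namespace IsStdBrownian

variable {Ω : Type*} {mΩ : MeasurableSpace Ω} {P : Measure Ω} [IsProbabilityMeasure P]
  {F : MeasureTheory.Filtration ℝ mΩ} {B : ℝ → Ω → ℝ}

lemma hasLaw_sum (hB : IsStdBrownian P F B) {τ : ℕ → ℝ} (hτ0 : ∀ n, 0 ≤ τ n) (hτ : Monotone τ)
    (w : ℕ → ℝ) (n : ℕ) :
    Measurable[F (τ n)] (fun ω => ∑ j ∈ Finset.range n, w j * (B (τ (j + 1)) ω - B (τ j) ω)) ∧
    HasLaw (fun ω => ∑ j ∈ Finset.range n, w j * (B (τ (j + 1)) ω - B (τ j) ω))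
      (gaussianReal 0 (∑ j ∈ Finset.range n, w j ^ 2 * (τ (j + 1) - τ j)).toNNReal) P := by
  induction n with
  | zero => 
    refine ⟨by simp, by simp, ?_⟩
    simp [Measure.map_const, gaussianReal_zero_var]
  | succ n ih =>
    have hle := hτ n.le_succ
    have hm : Measurable[F (τ (n + 1))]
        (fun ω => ∑ j ∈ Finset.range (n + 1), w j * (B (τ (j + 1)) ω - B (τ j) ω)) := by
      refine Finset.measurable_fun_sum _ fun j hj => ?_
      have hj' := Finset.mem_range.1 hj
      exact (((hB.1 _).mono (F.mono (hτ hj')) le_rfl).sub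
        ((hB.1 _).mono (F.mono (hτ hj'.le)) le_rfl)).const_mul _
    refine ⟨hm, ⟨(hm.mono (F.le _) le_rfl).aemeasurable, ?_⟩⟩
    have hinc : HasLaw (fun ω => B (τ (n + 1)) ω - B (τ n) ω)
        (gaussianReal 0 (τ (n + 1) - τ n).toNNReal) P :=
      ⟨((hB.measurable _).sub (hB.measurable _)).aemeasurable, hB.2.2.2.1 _ _ (hτ0 n) hle⟩
    have hind : IndepFun
        (fun ω => ∑ j ∈ Finset.range n, w j * (B (τ (j + 1)) ω - B (τ j) ω))
        (fun ω => w n * (B (τ (n + 1)) ω - B (τ n) ω)) P := by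
      have h := hB.2.2.2.2 _ _ (hτ0 n) hle
      refine IndepFun.symm (IndepFun_iff_Indep _ _ _ |>.2 ?_)
      refine indep_of_indep_of_le_left (indep_of_indep_of_le_right h (measurable_iff_comap_le.1 ih.1)) ?_
      exact measurable_iff_comap_le.1 ((comap_measurable _).const_mul _)
    have h := gaussianReal_add_gaussianReal_of_indepFun hind ih.2.map_eq
      (gaussianReal_const_mul hinc (w n)).map_eq
    have e : (fun ω => ∑ j ∈ Finset.range (n + 1), w j * (B (τ (j + 1)) ω - B (τ j) ω))
        = (fun ω => ∑ j ∈ Finset.range n, w j * (B (τ (j + 1)) ω - B (τ j) ω))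
          + fun ω => w n * (B (τ (n + 1)) ω - B (τ n) ω) := by
      ext ω; simp [Finset.sum_range_succ]
    rw [e, h, Finset.sum_range_succ]
    have hd : 0 ≤ τ (n + 1) - τ n := sub_nonneg.2 hle
    congr 1
    · simp
    · rw [Real.toNNReal_add (Finset.sum_nonneg fun j _ =>
        mul_nonneg (sq_nonneg _) (sub_nonneg.2 (hτ j.le_succ))) (by positivity),
        Real.toNNReal_mul (sq_nonneg _)]
      congr 2
      ext
      simp [sq_nonneg]

end IsStdBrownian

namespace IsDecayingSolution

variable {b : ℝ} {p q : ℝ → ℝ} {c K : ℝ}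

lemma integrableOn_mul_q (h : IsDecayingSolution b p q c K) {f : ℝ → ℝ} {M : ℝ}
    (hf : AEStronglyMeasurable f (volume.restrict (Ioi 0)))
    (hM : ∀ s, 0 < s → |f s| ≤ M * (1 + s) ^ 6) :
    IntegrableOn (fun s => f s * q (max s 0)) (Ioi 0) := by
  have hi := (integrableOn_add_rpow_Ioi_of_lt (a := -2) (c := 0) (m := 1) (by norm_num)
    (by norm_num)).const_mul (M * K)
  refine hi.mono' (hf.mul h.continuous_q_max.aestronglyMeasurable) ?_
  filter_upwards [ae_restrict_mem measurableSet_Ioi] with s hs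
  have hs0 : (0 : ℝ) < s := hs
  have h1 := h.q_le s hs0.le
  have h2 := h.q_pos s hs0.le
  have h3 := hM s hs0
  rw [norm_mul, max_eq_left hs0.le, norm_of_nonneg h2.le, Real.norm_eq_abs]
  refine (mul_le_mul h3 h1 h2.le ((abs_nonneg _).trans h3)).trans (le_of_eq ?_)
  have h4 : (s + 1) ^ (-2 : ℝ) = ((1 + s) ^ 2)⁻¹ := by
    rw [Real.rpow_neg (by positivity), add_comm]
    norm_cast
  rw [h4]
  field_simp

lemma integrableOn_bound (h : IsDecayingSolution b p q c K) (M : ℝ) :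
    IntegrableOn (fun s => (M * (1 + s) ^ 6) * q (max s 0)) (Ioi 0) :=
  h.integrableOn_mul_q (M := |M|) (by fun_prop) fun s hs => by
    rw [abs_mul, abs_of_nonneg (a := (1 + s) ^ 6) (by positivity)]

lemma integral_q_max (h : IsDecayingSolution b p q c K) {s t : ℝ} (hs : 0 ≤ s) (hst : s ≤ t) :
    ∫ u in s..t, q (max u 0) = p s - p t := by
  have := intervalIntegral.integral_eq_sub_of_hasDerivAt (a := s) (b := t) (f := p)
    (f' := fun u => - q (max u 0)) (fun u hu => ?_) ?_
  · rw [intervalIntegral.integral_neg] at this; linarith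
  · rw [uIcc_of_le hst] at hu
    rw [max_eq_left (hs.trans hu.1)]
    exact h.hasDerivAt_p u (hs.trans hu.1)
  · exact h.continuous_q_max.neg.intervalIntegrable _ _

lemma sum_mul_sub_eq (h : IsDecayingSolution b p q c K) {β : ℝ → ℝ} (hβ0 : β 0 = 0)
    {N : ℕ} (hN : 0 < N) (m : ℕ) :
    ∑ j ∈ Finset.range m, p ((j + 1 : ℕ) / N) * (β ((j + 1 : ℕ) / N) - β ((j : ℕ) / N))
      = (∫ s in (0:ℝ)..(m / N : ℝ), β (((⌈s * N⌉₊ : ℝ) - 1) / N) * q (max s 0))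
        + β (m / N) * p (m / N) := by
  have hN' : (0 : ℝ) < N := by exact_mod_cast hN
  have hle : ∀ k : ℕ, (k / N : ℝ) ≤ (k + 1 : ℕ) / N := fun k => by push_cast; gcongr; linarith
  have hc : ∀ k : ℕ, EqOn (fun s : ℝ => β (((⌈s * N⌉₊ : ℝ) - 1) / N) * q (max s 0))
      (fun s => β (k / N) * q (max s 0)) (Ioc (k / N : ℝ) ((k + 1 : ℕ) / N)) := by
    intro k s hs
    have h1 : ⌈s * N⌉₊ = k + 1 := by
      rw [Nat.ceil_eq_iff (by simp)]
      refine ⟨?_, (le_div_iff₀ hN').1 hs.2⟩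
      simpa using (div_lt_iff₀ hN').1 hs.1
    simp only [h1]
    push_cast
    simp
  have hI : ∀ k : ℕ, ∫ s in (k / N : ℝ)..((k + 1 : ℕ) / N : ℝ),
      β (((⌈s * N⌉₊ : ℝ) - 1) / N) * q (max s 0)
        = β (k / N) * (p (k / N) - p ((k + 1 : ℕ) / N)) := by
    intro k
    rw [intervalIntegral.integral_of_le (hle k), setIntegral_congr_fun measurableSet_Ioc (hc k),
      ← intervalIntegral.integral_of_le (hle k), intervalIntegral.integral_const_mul,
      h.integral_q_max (by positivity) (hle k)]
  have hint : ∀ k < m, IntervalIntegrable (fun s => β (((⌈s * N⌉₊ : ℝ) - 1) / N) * q (max s 0))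
      volume ((fun k : ℕ => (k / N : ℝ)) k) ((fun k : ℕ => (k / N : ℝ)) (k + 1)) := by
    intro k _
    refine IntervalIntegrable.congr (f := fun s => β (k / N) * q (max s 0)) ?_
      ((continuous_const.mul h.continuous_q_max).intervalIntegrable _ _)
    rw [uIoc_of_le (hle k)]
    exact fun s hs => (hc k hs).symm
  have hsum := intervalIntegral.sum_integral_adjacent_intervals hint
  simp only [Nat.cast_zero, zero_div] at hsum
  rw [← hsum]
  simp only [hI]
  clear hsum hint
  induction m with
  | zero => simp [hβ0]
  | succ m ih =>
    rw [Finset.sum_range_succ, ih, Finset.sum_range_succ]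
    ring

lemma tendsto_mul_p (h : IsDecayingSolution b p q c K) {β : ℝ → ℝ} {M : ℝ}
    (hM : ∀ t, 0 ≤ t → |β t| ≤ M * (1 + t) ^ 3) : Tendsto (fun t => β t * p t) atTop (nhds 0) := by
  have h1 : Tendsto (fun t : ℝ => M * K * (1 + t)⁻¹) atTop (nhds 0) := by
    have := (tendsto_inv_atTop_zero.comp (tendsto_atTop_add_const_left atTop (1 : ℝ) tendsto_id)).const_mul (M * K)
    simpa [Function.comp_def] using this
  refine squeeze_zero_norm' ?_ h1
  filter_upwards [eventually_ge_atTop 0] with t ht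
  have h2 := hM t ht
  have h3 := h.p_le t ht
  rw [norm_mul, norm_of_nonneg (h.p_pos t ht).le, Real.norm_eq_abs]
  have hM0 : 0 ≤ M := by
    have := (abs_nonneg _).trans h2
    by_contra hneg
    have : M * (1 + t) ^ 3 < 0 := mul_neg_of_neg_of_pos (by linarith) (by positivity)
    linarith
  have hK := h.K_pos
  refine (mul_le_mul h2 h3 (h.p_pos t ht).le ((abs_nonneg _).trans h2)).trans ?_
  have e : M * (1 + t) ^ 3 * (K / (1 + t) ^ 8) = M * K * ((1 + t) ^ 5)⁻¹ := by field_simp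
  rw [e]
  gcongr
  exact le_self_pow₀ (by linarith) (by norm_num)

lemma tendsto_sum_mul_sub (h : IsDecayingSolution b p q c K) {β : ℝ → ℝ} (hβ : Continuous β)
    (hβ0 : β 0 = 0) {M : ℝ} (hM : ∀ t, 0 ≤ t → |β t| ≤ M * (1 + t) ^ 3) :
    Tendsto (fun n : ℕ => ∑ j ∈ Finset.range ((n + 1) * (n + 1)),
      p ((j + 1 : ℕ) / (n + 1 : ℕ)) * (β ((j + 1 : ℕ) / (n + 1 : ℕ)) - β ((j : ℕ) / (n + 1 : ℕ))))
      atTop (nhds (∫ s in Ioi 0, β s * q (max s 0))) := by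
  have hM0 : 0 ≤ M := by have := (abs_nonneg _).trans (hM 0 le_rfl); simpa using this
  have e : ∀ n : ℕ, (((n + 1) * (n + 1) : ℕ) : ℝ) / (n + 1 : ℕ) = (n : ℝ) + 1 := fun n => by
    push_cast; field_simp
  simp only [h.sum_mul_sub_eq hβ0 (Nat.succ_pos _), e]
  have h0 : Tendsto (fun n : ℕ => (n : ℝ) + 1) atTop atTop :=
    tendsto_atTop_add_const_right _ _ tendsto_natCast_atTop_atTop
  rw [← add_zero (∫ s in Ioi 0, β s * q (max s 0))]
  refine Tendsto.add ?_ ((h.tendsto_mul_p hM).comp h0)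
  have e2 : ∀ n : ℕ, ∫ s in (0:ℝ)..((n : ℝ) + 1),
      β (((⌈s * (n + 1 : ℕ)⌉₊ : ℝ) - 1) / (n + 1 : ℕ)) * q (max s 0)
      = ∫ s in Ioi 0, (Ioc 0 ((n : ℝ) + 1)).indicator
        (fun s => β (((⌈s * (n + 1 : ℕ)⌉₊ : ℝ) - 1) / (n + 1 : ℕ)) * q (max s 0)) s := by
    intro n
    rw [setIntegral_indicator measurableSet_Ioc, intervalIntegral.integral_of_le (by positivity),
      inter_eq_right.2 Ioc_subset_Ioi_self]
  simp only [e2]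
  refine tendsto_integral_of_dominated_convergence _ (fun n => ?_) (h.integrableOn_bound M)
    (fun n => ?_) ?_
  · refine (Measurable.indicator ?_ measurableSet_Ioc).aestronglyMeasurable
    refine (hβ.measurable.comp ?_).mul h.continuous_q_max.measurable
    have : Measurable fun s : ℝ => (⌈s * (n + 1 : ℕ)⌉₊ : ℝ) :=
      (measurable_from_top (f := fun k : ℕ => (k : ℝ))).comp
        (Nat.measurable_ceil.comp (measurable_id.mul_const _))
    exact (this.sub_const _).div_const _
  · filter_upwards [ae_restrict_mem measurableSet_Ioi] with s hs
    have hs0 : (0 : ℝ) < s := hs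
    have hq := h.q_pos s hs0.le
    refine (norm_indicator_le_norm_self _ _).trans ?_
    rw [norm_mul, max_eq_left hs0.le, norm_of_nonneg hq.le, Real.norm_eq_abs]
    gcongr
    have hn : (0 : ℝ) < (n + 1 : ℕ) := by positivity
    have h1 := Nat.ceil_lt_add_one (a := s * (n + 1 : ℕ)) (by positivity)
    have h2 : 1 ≤ ⌈s * (n + 1 : ℕ)⌉₊ := Nat.one_le_ceil_iff.2 (by positivity)
    have h2' : (1 : ℝ) ≤ ⌈s * (n + 1 : ℕ)⌉₊ := by exact_mod_cast h2
    have h3 : 0 ≤ ((⌈s * (n + 1 : ℕ)⌉₊ : ℝ) - 1) / (n + 1 : ℕ) :=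
      div_nonneg (by linarith) hn.le
    have h4 : ((⌈s * (n + 1 : ℕ)⌉₊ : ℝ) - 1) / (n + 1 : ℕ) ≤ s := by
      rw [div_le_iff₀ hn]; linarith
    refine (hM _ h3).trans ?_
    gcongr M * ?_
    calc _ ≤ (1 + s) ^ 3 := by gcongr
      _ ≤ (1 + s) ^ 6 := pow_le_pow_right₀ (by linarith) (by norm_num)
  · filter_upwards [ae_restrict_mem measurableSet_Ioi] with s hs
    have hs0 : (0 : ℝ) < s := hs
    have h1 : Tendsto (fun n : ℕ => ((⌈s * (n + 1 : ℕ)⌉₊ : ℝ) - 1) / (n + 1 : ℕ)) atTop (nhds s) := by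
      have h2 := ((tendsto_nat_ceil_mul_div_atTop hs0.le).comp h0).sub (tendsto_inv_atTop_zero.comp h0)
      rw [sub_zero] at h2
      refine h2.congr fun n => ?_
      simp only [Function.comp_apply]
      push_cast
      rw [sub_div, one_div]
    have h3 := ((hβ.tendsto s).comp h1).mul_const (q (max s 0))
    refine h3.congr' ?_
    filter_upwards [h0.eventually_ge_atTop s] with n hn
    rw [indicator_of_mem (show s ∈ Ioc 0 ((n : ℝ) + 1) from ⟨hs0, hn⟩)]
    rfl

end IsDecayingSolution

lemma IsDecayingSolution.sum_sq_le {b : ℝ} {p q : ℝ → ℝ} {c K : ℝ}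
    (h : IsDecayingSolution b p q c K) {N : ℕ} (hN : 0 < N) (m : ℕ) :
    ∑ j ∈ Finset.range m, p ((j + 1 : ℕ) / N) ^ 2 * ((j + 1 : ℕ) / N - (j : ℕ) / N) ≤ K ^ 2 := by
  have hN' : (0 : ℝ) < N := by exact_mod_cast hN
  have hK := h.K_pos
  suffices H : ∑ j ∈ Finset.range m, p ((j + 1 : ℕ) / N) ^ 2 * ((j + 1 : ℕ) / N - (j : ℕ) / N)
      ≤ K ^ 2 * (1 - (1 + (m / N : ℝ))⁻¹) by
    refine H.trans (mul_le_of_le_one_right (by positivity) ?_)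
    have : 0 ≤ (1 + (m / N : ℝ))⁻¹ := by positivity
    linarith
  induction m with
  | zero => simp
  | succ m ih =>
    rw [Finset.sum_range_succ]
    set x : ℝ := (m : ℕ) / N with hx
    set y : ℝ := ((m + 1 : ℕ) : ℝ) / N with hy
    have hx0 : 0 ≤ x := by positivity
    have hxy : x ≤ y := by rw [hx, hy]; push_cast; gcongr; linarith
    have hy0 := hx0.trans hxy
    have h1 : p y ^ 2 ≤ K ^ 2 * ((1 + y) ^ 2)⁻¹ := by
      rw [← div_eq_mul_inv, ← div_pow]
      have h2 : K / (1 + y) ^ 8 ≤ K / (1 + y) := by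
        gcongr
        exact le_self_pow₀ (by linarith) (by norm_num)
      exact pow_le_pow_left₀ (h.p_pos y hy0).le ((h.p_le y hy0).trans h2) 2
    have h2 : ((1 + y) ^ 2)⁻¹ * (y - x) ≤ (1 + x)⁻¹ - (1 + y)⁻¹ := by
      have : (1 + x)⁻¹ - (1 + y)⁻¹ = ((1 + x) * (1 + y))⁻¹ * (y - x) := by field_simp; ring
      rw [this, sq]
      gcongr
    have h3 := mul_le_mul_of_nonneg_right h1 (sub_nonneg.2 hxy)
    have h4 := mul_le_mul_of_nonneg_left h2 (sq_nonneg K)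
    nlinarith

lemma IsDecayingSolution.le_sum_sq {b : ℝ} {p q : ℝ → ℝ} {c K : ℝ}
    (h : IsDecayingSolution b p q c K) {N m : ℕ} (hN : 0 < N) (hm : N ≤ m) :
    p 1 ^ 2 ≤
      ∑ j ∈ Finset.range m, p ((j + 1 : ℕ) / N) ^ 2 * ((j + 1 : ℕ) / N - (j : ℕ) / N) := by
  have hN' : (0 : ℝ) < N := by exact_mod_cast hN
  have hd : ∀ j : ℕ, ((j + 1 : ℕ) : ℝ) / N - (j : ℕ) / N = 1 / N := fun j => by push_cast; ring
  simp only [hd]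
  refine le_trans ?_ (Finset.sum_le_sum_of_subset_of_nonneg (Finset.range_mono hm)
    fun j _ _ => by positivity)
  calc p 1 ^ 2 = ∑ j ∈ Finset.range N, p 1 ^ 2 * (1 / N : ℝ) := by
        rw [Finset.sum_const, Finset.card_range, nsmul_eq_mul]; field_simp
    _ ≤ _ := by
        refine Finset.sum_le_sum fun j hj => ?_
        have h0 : 0 ≤ ((j + 1 : ℕ) : ℝ) / N := by positivity
        have h1 : ((j + 1 : ℕ) : ℝ) / N ≤ 1 :=
          div_le_one_of_le₀ (by exact_mod_cast Finset.mem_range.1 hj) hN'.le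
        have h2 := h.antitoneOn_p h0 (h0.trans h1) h1
        have h3 := (h.p_pos 1 zero_le_one).le
        gcongr

namespace IsStdBrownian

variable {Ω : Type*} {mΩ : MeasurableSpace Ω} {P : Measure Ω}
  {F : MeasureTheory.Filtration ℝ mΩ} {B : ℝ → Ω → ℝ}
  {b : ℝ} {p q : ℝ → ℝ} {c K : ℝ}

lemma measurable_uncurry (hB : IsStdBrownian P F B) : Measurable (fun z : ℝ × Ω => B z.1 z.2) :=
  measurable_uncurry_of_continuous_of_measurable hB.2.2.1 hB.measurable

lemma measurable_integral_mul (hB : IsStdBrownian P F B) (h : IsDecayingSolution b p q c K) :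
    Measurable fun ω => ∫ s in Ioi 0, B s ω * q (max s 0) := by
  have h1 : Measurable fun z : Ω × ℝ => B z.2 z.1 * q (max z.2 0) :=
    (hB.measurable_uncurry.comp measurable_swap).mul
      (h.continuous_q_max.measurable.comp measurable_snd)
  exact (h1.stronglyMeasurable.integral_prod_right (ν := volume.restrict (Ioi 0))).measurable

variable [IsProbabilityMeasure P]

lemma exists_map_integral_eq (hB : IsStdBrownian P F B) (h : IsDecayingSolution b p q c K) :
    ∃ v : NNReal, 0 < v ∧
      P.map (fun ω => ∫ s in Ioi 0, B s ω * q (max s 0)) = gaussianReal 0 v := by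
  have hp1 := h.p_pos 1 zero_le_one
  have hlim : ∀ᵐ ω ∂P, Tendsto (fun n : ℕ => ∑ j ∈ Finset.range ((n + 1) * (n + 1)),
      p ((j + 1 : ℕ) / (n + 1 : ℕ)) *
        (B ((j + 1 : ℕ) / (n + 1 : ℕ)) ω - B ((j : ℕ) / (n + 1 : ℕ)) ω)) atTop
      (nhds (∫ s in Ioi 0, B s ω * q (max s 0))) := by
    filter_upwards [hB.ae_exists_abs_le] with ω ⟨M, hM⟩
    exact h.tendsto_sum_mul_sub (hB.2.2.1 ω) (hB.2.1 ω) hM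
  obtain ⟨v, hv, hmap⟩ := exists_map_eq_gaussianReal_of_tendsto
    (hB.measurable_integral_mul h).aemeasurable
    (l := (p 1 ^ 2).toNNReal) (u := (K ^ 2).toNNReal)
    (v := fun n => (∑ j ∈ Finset.range ((n + 1) * (n + 1)), p ((j + 1 : ℕ) / (n + 1 : ℕ)) ^ 2 *
      ((j + 1 : ℕ) / (n + 1 : ℕ) - (j : ℕ) / (n + 1 : ℕ))).toNNReal)
    (fun n => ⟨Real.toNNReal_le_toNNReal (h.le_sum_sq n.succ_pos (Nat.le_mul_of_pos_left _ n.succ_pos)),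
      Real.toNNReal_le_toNNReal (h.sum_sq_le n.succ_pos _)⟩)
    (fun n => (hB.hasLaw_sum (τ := fun j : ℕ => (j : ℝ) / (n + 1 : ℕ)) (fun j => by positivity)
      (fun i j hij => by simp only; gcongr) (fun j : ℕ => p ((j + 1 : ℕ) / (n + 1 : ℕ))) _).2) hlim
  exact ⟨v, lt_of_lt_of_le (Real.toNNReal_pos.2 (by positivity)) hv.1, hmap⟩

/-- Brownian motion has an integrable weighted square norm on `(0, ∞)`. -/
lemma integrable_integral_sq (hB : IsStdBrownian P F B) (h : IsDecayingSolution b p q c K) :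
    Integrable (fun ω => ∫ s in Ioi 0, B s ω ^ 2 * q (max s 0)) P := by
  have h1 : Measurable fun z : ℝ × Ω => B z.1 z.2 ^ 2 * q (max z.1 0) :=
    (hB.measurable_uncurry.pow_const 2).mul (h.continuous_q_max.measurable.comp measurable_fst)
  have h2 : Integrable (fun z : ℝ × Ω => B z.1 z.2 ^ 2 * q (max z.1 0))
      ((volume.restrict (Ioi 0)).prod P) := by
    rw [integrable_prod_iff h1.aestronglyMeasurable]
    constructor
    · filter_upwards [ae_restrict_mem measurableSet_Ioi] with s hs
      exact (hB.memLp (le_of_lt hs)).integrable_sq.mul_const _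
    · refine (h.integrableOn_mul_q (f := fun s => s) (M := 1) (by fun_prop) fun s hs => ?_).congr ?_
      · rw [abs_of_pos hs, one_mul]
        exact (by linarith : s ≤ 1 + s).trans (le_self_pow₀ (by linarith) (by norm_num))
      · filter_upwards [ae_restrict_mem measurableSet_Ioi] with s hs
        have hs0 : (0 : ℝ) ≤ s := le_of_lt hs
        have hq : 0 ≤ q (max s 0) := (h.q_pos _ (le_max_right _ _)).le
        simp only [norm_of_nonneg (mul_nonneg (sq_nonneg (B s _)) hq)]
        rw [integral_mul_const, hB.integral_sq hs0]
  exact h2.integral_prod_right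

end IsStdBrownian

lemma IsDecayingSolution.sq_integral_abs_le {b : ℝ} {p q : ℝ → ℝ} {c K : ℝ}
    (h : IsDecayingSolution b p q c K) {β : ℝ → ℝ} (hβ : Continuous β) {M : ℝ}
    (hM : ∀ t, 0 ≤ t → |β t| ≤ M * (1 + t) ^ 3) {t : ℝ} (ht : 0 ≤ t) :
    (∫ s in (0:ℝ)..t, |β s| * q (max s 0)) ^ 2 ≤
      (∫ s in Ioi 0, q (max s 0)) * ∫ s in Ioi 0, β s ^ 2 * q (max s 0) := by
  have hq : ∀ s, 0 ≤ q (max s 0) := fun s => (h.q_pos _ (le_max_right _ _)).le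
  have hM0 : 0 ≤ M := by have := (abs_nonneg _).trans (hM 0 le_rfl); simpa using this
  have hi1 : IntegrableOn (fun s => |β s| * q (max s 0)) (Ioi 0) :=
    h.integrableOn_mul_q (M := M) hβ.abs.aestronglyMeasurable fun s hs => by
      rw [abs_abs]
      refine (hM s hs.le).trans ?_
      gcongr M * ?_
      exact pow_le_pow_right₀ (by linarith) (by norm_num)
  have hi2 : IntegrableOn (fun s => β s ^ 2 * q (max s 0)) (Ioi 0) :=
    h.integrableOn_mul_q (M := M ^ 2) (hβ.pow 2).aestronglyMeasurable fun s hs => by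
      rw [abs_pow]
      refine (pow_le_pow_left₀ (abs_nonneg _) (hM s hs.le) 2).trans (le_of_eq ?_)
      ring
  have hi0 : IntegrableOn (fun s => q (max s 0)) (Ioi 0) := by
    simpa using h.integrableOn_mul_q (f := fun _ => 1) (M := 1) (by fun_prop) fun s hs => by
      rw [abs_one, one_mul]
      exact one_le_pow₀ (by linarith)
  set J := ∫ s in Ioi 0, |β s| * q (max s 0)
  have hJ : (∫ s in (0:ℝ)..t, |β s| * q (max s 0)) ≤ J := by
    rw [intervalIntegral.integral_of_le ht]
    exact setIntegral_mono_set hi1 (Eventually.of_forall fun s => mul_nonneg (abs_nonneg _) (hq s))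
      (Eventually.of_forall Ioc_subset_Ioi_self)
  have hJ0 : 0 ≤ ∫ s in (0:ℝ)..t, |β s| * q (max s 0) :=
    intervalIntegral.integral_nonneg ht fun s _ => mul_nonneg (abs_nonneg _) (hq s)
  refine (pow_le_pow_left₀ hJ0 hJ 2).trans ?_
  have hquad : ∀ x : ℝ, 0 ≤ (∫ s in Ioi 0, q (max s 0)) * (x * x) + (-2 * J) * x
      + ∫ s in Ioi 0, β s ^ 2 * q (max s 0) := by
    intro x
    have e : (∫ s in Ioi 0, q (max s 0)) * (x * x) + (-2 * J) * x
        + ∫ s in Ioi 0, β s ^ 2 * q (max s 0)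
        = ∫ s in Ioi 0, (q (max s 0) * (x * x) + (|β s| * q (max s 0)) * (-2 * x)
          + β s ^ 2 * q (max s 0)) := by
      have h3 := integral_add ((hi0.mul_const (x * x)).add (hi1.mul_const (-2 * x))) hi2
      have h4 := integral_add (hi0.mul_const (x * x)) (hi1.mul_const (-2 * x))
      simp only [Pi.add_apply] at h3
      rw [h3, h4, integral_mul_const, integral_mul_const]
      ring
    rw [e]
    refine integral_nonneg fun s => ?_
    have h2 : q (max s 0) * (x * x) + (|β s| * q (max s 0)) * (-2 * x) + β s ^ 2 * q (max s 0)
        = (|β s| - x) ^ 2 * q (max s 0) := by rw [← sq_abs (β s)]; ring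
    simp only [h2]
    exact mul_nonneg (sq_nonneg _) (hq s)
  have hd := discrim_le_zero hquad
  rw [discrim] at hd
  nlinarith

/-- Perturbing an `L²`-dominated convergent family by a multiple of Brownian motion whose
coefficient decays does not change the limits of the first two moments. -/
lemma tendsto_moments_of_dominated {Ω : Type*} {mΩ : MeasurableSpace Ω} {P : Measure Ω}
    [IsProbabilityMeasure P] {F : MeasureTheory.Filtration ℝ mΩ} {B : ℝ → Ω → ℝ}
    (hB : IsStdBrownian P F B) {Y : ℝ → Ω → ℝ} {Z D : Ω → ℝ} {r : ℝ → ℝ}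
    (hY : ∀ t, 0 ≤ t → AEStronglyMeasurable (Y t) P) (hZ : AEStronglyMeasurable Z P)
    (hr : Tendsto r atTop (nhds 0)) (hrt : Tendsto (fun t => t * r t) atTop (nhds 0))
    (hD : Integrable D P)
    (hbound : ∀ᵐ ω ∂P, ∀ t, 0 ≤ t → (Y t ω - B t ω * r t) ^ 2 ≤ D ω)
    (hlim : ∀ᵐ ω ∂P, Tendsto (fun t => Y t ω - B t ω * r t) atTop (nhds (Z ω))) :
    (∀ t, 0 ≤ t → MemLp (Y t) 2 P) ∧
    Tendsto (fun t => ∫ ω, Y t ω ∂P) atTop (nhds (∫ ω, Z ω ∂P)) ∧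
    Tendsto (fun t => variance (Y t) P) atTop (nhds (variance Z P)) := by
  set A : ℝ → Ω → ℝ := fun t ω => Y t ω - B t ω * r t with hA
  have hAm : ∀ t, 0 ≤ t → AEStronglyMeasurable (A t) P := fun t ht =>
    (hY t ht).sub ((hB.measurable t).mul_const _).aestronglyMeasurable
  have hA2 : ∀ t, 0 ≤ t → MemLp (A t) 2 P := by
    intro t ht
    rw [memLp_two_iff_integrable_sq (hAm t ht)]
    refine hD.mono' ((hAm t ht).pow 2) ?_
    filter_upwards [hbound] with ω hω
    rw [norm_of_nonneg (sq_nonneg _)]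
    exact hω t ht
  have hBr : ∀ t, 0 ≤ t → MemLp (fun ω => B t ω * r t) 2 P := fun t ht => (hB.memLp ht).mul_const _
  have hYA : ∀ t, Y t = fun ω => A t ω + B t ω * r t := fun t => by ext ω; simp [hA]
  have hY2 : ∀ t, 0 ≤ t → MemLp (Y t) 2 P := fun t ht => by
    rw [hYA]; exact (hA2 t ht).add (hBr t ht)
  have hZ2 : MemLp Z 2 P := by
    rw [memLp_two_iff_integrable_sq hZ]
    refine hD.mono' (hZ.pow 2) ?_
    filter_upwards [hbound, hlim] with ω h1 h2
    rw [norm_of_nonneg (sq_nonneg _)]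
    exact le_of_tendsto (h2.pow 2) ((eventually_ge_atTop 0).mono fun t ht => h1 t ht)
  have hm1 : Tendsto (fun t => ∫ ω, A t ω ∂P) atTop (nhds (∫ ω, Z ω ∂P)) := by
    refine tendsto_integral_filter_of_dominated_convergence (fun ω => 1 + D ω)
      ((eventually_ge_atTop 0).mono hAm) ?_ ((integrable_const _).add hD) hlim
    filter_upwards [eventually_ge_atTop 0] with t ht
    filter_upwards [hbound] with ω hω
    have h1 : A t ω ^ 2 ≤ D ω := hω t ht
    rw [Real.norm_eq_abs]
    have h2 := sq_abs (A t ω)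
    nlinarith [sq_nonneg (|A t ω| - 1), abs_nonneg (A t ω)]
  have hm2 : Tendsto (fun t => ∫ ω, A t ω ^ 2 ∂P) atTop (nhds (∫ ω, Z ω ^ 2 ∂P)) := by
    refine tendsto_integral_filter_of_dominated_convergence D
      ((eventually_ge_atTop 0).mono fun t ht => (hAm t ht).pow 2) ?_ hD
      (hlim.mono fun ω hω => hω.pow 2)
    filter_upwards [eventually_ge_atTop 0] with t ht
    filter_upwards [hbound] with ω hω
    rw [norm_of_nonneg (sq_nonneg _)]
    exact hω t ht
  have hmean : ∀ t, 0 ≤ t → ∫ ω, Y t ω ∂P = ∫ ω, A t ω ∂P := by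
    intro t ht
    rw [hYA, integral_add ((hA2 t ht).integrable (by norm_num))
      ((hBr t ht).integrable (by norm_num)), integral_mul_const, hB.integral_eq_zero ht]
    simp
  have hY1 : Tendsto (fun t => ∫ ω, Y t ω ∂P) atTop (nhds (∫ ω, Z ω ∂P)) :=
    hm1.congr' ((eventually_ge_atTop 0).mono fun t ht => (hmean t ht).symm)
  have hcross : Tendsto (fun t => ∫ ω, Y t ω ^ 2 ∂P - ∫ ω, A t ω ^ 2 ∂P) atTop (nhds 0) := by
    have hb : Tendsto (fun t => |r t| * (∫ ω, A t ω ^ 2 ∂P) + |t * r t| + |t * r t| * |r t|)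
        atTop (nhds 0) := by
      have := ((hr.abs.mul hm2).add hrt.abs).add (hrt.abs.mul hr.abs)
      simpa using this
    refine squeeze_zero_norm' ?_ hb
    filter_upwards [eventually_ge_atTop 0] with t ht
    have i1 := (hA2 t ht).integrable_sq
    have i2 := (hB.memLp ht).integrable_sq
    have i3 : Integrable (fun ω => A t ω * B t ω) P := (hA2 t ht).integrable_mul (hB.memLp ht)
    have e : ∫ ω, Y t ω ^ 2 ∂P = ∫ ω, A t ω ^ 2 ∂P + (∫ ω, A t ω * B t ω ∂P) * (2 * r t)
        + t * r t ^ 2 := by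
      have e1 : ∀ ω, Y t ω ^ 2 = A t ω ^ 2 + (A t ω * B t ω) * (2 * r t) + B t ω ^ 2 * r t ^ 2 :=
        fun ω => by rw [hYA]; ring
      simp only [e1]
      have h1 := integral_add (i1.add (i3.mul_const (2 * r t))) (i2.mul_const (r t ^ 2))
      have h2 := integral_add i1 (i3.mul_const (2 * r t))
      simp only [Pi.add_apply] at h1
      rw [h1, h2, integral_mul_const, integral_mul_const, hB.integral_sq ht]
    have hAB : |∫ ω, A t ω * B t ω ∂P| * 2 ≤ ∫ ω, A t ω ^ 2 ∂P + t := by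
      have h1 := integral_add i1 i2
      rw [hB.integral_sq ht] at h1
      rw [← h1]
      refine (mul_le_mul_of_nonneg_right (abs_integral_le_integral_abs) zero_le_two).trans ?_
      rw [← integral_mul_const]
      refine integral_mono (i3.abs.mul_const _) (i1.add i2) fun ω => ?_
      simp only [abs_mul]
      nlinarith [sq_nonneg (|A t ω| - |B t ω|), sq_abs (A t ω), sq_abs (B t ω)]
    rw [e, Real.norm_eq_abs]
    have e2 : ∫ ω, A t ω ^ 2 ∂P + (∫ ω, A t ω * B t ω ∂P) * (2 * r t) + t * r t ^ 2
        - ∫ ω, A t ω ^ 2 ∂P = (∫ ω, A t ω * B t ω ∂P) * 2 * r t + t * r t * r t := by ring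
    rw [e2]
    refine (abs_add_le _ _).trans ?_
    rw [abs_mul, abs_mul, abs_two, abs_mul (t * r t), abs_mul t, abs_of_nonneg ht]
    have := mul_le_mul_of_nonneg_right hAB (abs_nonneg (r t))
    linarith
  have hYsq : Tendsto (fun t => ∫ ω, Y t ω ^ 2 ∂P) atTop (nhds (∫ ω, Z ω ^ 2 ∂P)) := by
    simpa using hcross.add hm2
  refine ⟨hY2, hY1, ?_⟩
  rw [variance_eq_sub hZ2]
  refine (hYsq.sub (hY1.pow 2)).congr' ?_
  filter_upwards [eventually_ge_atTop 0] with t ht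
  rw [variance_eq_sub (hY2 t ht)]
  rfl

lemma IsSolutionSFDE.ae_isPathSolution {Ω : Type*} {mΩ : MeasurableSpace Ω} {P : Measure Ω}
    {F : MeasureTheory.Filtration ℝ mΩ} {b σ : ℝ} {ψ : ℝ → ℝ} {B X : ℝ → Ω → ℝ}
    (hB : IsStdBrownian P F B) (hX : IsSolutionSFDE P F 0 b σ ψ B X) :
    ∀ᵐ ω ∂P, IsPathSolution b σ (ψ 0) (∫ u in (-1:ℝ)..(0:ℝ), ψ u) (fun t => B t ω)
      (fun t => X (max t 0) ω) := by
  filter_upwards [hX.2.2] with ω hω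
  refine ⟨hB.2.2.1 ω, (hX.2.1 ω).comp_continuous (by fun_prop) fun t => le_max_right t 0,
    fun t ht => ?_⟩
  rw [max_eq_left ht, hω t ht]
  congr 2
  refine intervalIntegral.integral_congr fun s hs => ?_
  rw [uIcc_of_le ht] at hs
  simp only [zero_mul, zero_add]
  congr 2
  refine intervalIntegral.integral_congr fun u hu => ?_
  rw [uIcc_of_le hs.1] at hu
  simp only [max_eq_left hu.1]

theorem sfde_subexp_growth {Ω : Type*} {mΩ : MeasurableSpace Ω} (P : Measure Ω) [IsProbabilityMeasure P]
    (F : MeasureTheory.Filtration ℝ mΩ) (a b σ : ℝ) (ψ : ℝ → ℝ) (B X : ℝ → Ω → ℝ)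
    (hσ : 0 < σ) (hψ : ContinuousOn ψ (Set.Icc (-1 : ℝ) 0))
    (hB : IsStdBrownian P F B) (hX : IsSolutionSFDE P F a b σ ψ B X)
    (ha : a = 0) (hb : 0 < b) :
    ∃ C : Ω → ℝ, Measurable C ∧
      (∃ m : ℝ, ∃ v : NNReal, 0 < v ∧ P.map C = gaussianReal m v) ∧
      (∀ᵐ ω ∂P, Filter.Tendsto
        (fun t : ℝ => X t ω / (t ^ (-(1:ℝ)/4) * Real.exp (2 * Real.sqrt (b * t))))
        Filter.atTop (nhds (C ω))) ∧
      Filter.Tendsto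
        (fun t : ℝ => (∫ ω, X t ω ∂P) / (t ^ (-(1:ℝ)/4) * Real.exp (2 * Real.sqrt (b * t))))
        Filter.atTop (nhds (∫ ω, C ω ∂P)) ∧
      Filter.Tendsto
        (fun t : ℝ => variance (X t) P / (t ^ (-(1:ℝ)/2) * Real.exp (4 * Real.sqrt (b * t))))
        Filter.atTop (nhds (variance C P)) := by
  subst ha
  obtain ⟨p, q, c, K, h⟩ := exists_isDecayingSolution hb
  set Ψ := ∫ u in (-1:ℝ)..(0:ℝ), ψ u with hΨ
  set Y : Ω → ℝ := fun ω => ∫ s in Ioi (0:ℝ), B s ω * q (max s 0) with hY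
  set Z : Ω → ℝ := fun ω => (ψ 0 * p 0 + q 0 * Ψ + σ * Y ω) / 2 with hZ
  have hYm : Measurable Y := hB.measurable_integral_mul h
  have hZm : Measurable Z := ((hYm.const_mul σ).const_add _).div_const 2
  have hXm : ∀ t, 0 ≤ t → Measurable (X t) := fun t ht =>
    (hX.1 t ht).measurable.mono (F.le t) le_rfl
  have hpath := hX.ae_isPathSolution hB
  have hc := h.c_pos
  have hrt : Tendsto (fun t => t * p t) atTop (nhds 0) :=
    h.tendsto_mul_p (β := fun t => t) (M := 1) fun t ht => by
      rw [abs_of_nonneg ht, one_mul]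
      exact (by linarith : t ≤ 1 + t).trans (le_self_pow₀ (by linarith) (by norm_num))
  have hr : Tendsto p atTop (nhds 0) := by
    simpa using h.tendsto_mul_p (β := fun _ => 1) (M := 1) fun t ht => by
      rw [abs_one, one_mul]
      exact one_le_pow₀ (by linarith)
  set k := 2 * |ψ 0 * p 0 + q 0 * Ψ| + q 0 * |Ψ| with hk
  have hlim : ∀ᵐ ω ∂P, Tendsto (fun t => X t ω * p t - B t ω * (σ * p t)) atTop (nhds (Z ω)) := by
    filter_upwards [hpath, hB.ae_exists_abs_le] with ω hx ⟨M, hM⟩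
    have hM0 : 0 ≤ M := by have := (abs_nonneg _).trans (hM 0 le_rfl); simpa using this
    have hi : IntegrableOn (fun s => B s ω * q (max s 0)) (Ioi 0) :=
      h.integrableOn_mul_q (M := M) (hB.2.2.1 ω).aestronglyMeasurable fun s hs => by
        refine (hM s hs.le).trans ?_
        gcongr M * ?_
        exact pow_le_pow_right₀ (by linarith) (by norm_num)
    refine (hx.tendsto_mul h hb hi (h.tendsto_mul_p hM)).congr' ?_
    filter_upwards [eventually_ge_atTop 0] with t ht
    rw [max_eq_left ht]
    ring
  have hbound : ∀ᵐ ω ∂P, ∀ t, 0 ≤ t → (X t ω * p t - B t ω * (σ * p t)) ^ 2 ≤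
      2 * k ^ 2 + 18 * σ ^ 2 * ((∫ s in Ioi (0:ℝ), q (max s 0)) *
        ∫ s in Ioi (0:ℝ), B s ω ^ 2 * q (max s 0)) := by
    filter_upwards [hpath, hB.ae_exists_abs_le] with ω hx ⟨M, hM⟩ t ht
    have h1 := hx.abs_mul_sub_le h hb ht
    have h2 := h.sq_integral_abs_le (hB.2.2.1 ω) hM ht
    simp only [max_eq_left ht] at h1
    set J := ∫ s in (0:ℝ)..t, |B s ω| * q (max s 0)
    have e : X t ω * p t - B t ω * (σ * p t) = X t ω * p t - σ * (B t ω * p t) := by ring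
    rw [e, ← sq_abs]
    have h3 := pow_le_pow_left₀ (abs_nonneg _) h1 2
    have h4 := add_sq_le (a := k) (b := 3 * |σ| * J)
    have h5 : (3 * |σ| * J) ^ 2 = 9 * σ ^ 2 * J ^ 2 := by rw [mul_pow, mul_pow, sq_abs]; ring
    have h6 := mul_le_mul_of_nonneg_left h2 (by positivity : 0 ≤ 18 * σ ^ 2)
    rw [h5] at h4
    linarith
  have hD : Integrable (fun ω => 2 * k ^ 2 + 18 * σ ^ 2 * ((∫ s in Ioi (0:ℝ), q (max s 0)) *
        ∫ s in Ioi (0:ℝ), B s ω ^ 2 * q (max s 0))) P :=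
    (integrable_const _).add (((hB.integrable_integral_sq h).const_mul _).const_mul _)
  obtain ⟨-, hmean, hvar⟩ := tendsto_moments_of_dominated hB (Y := fun t ω => X t ω * p t)
    (r := fun t => σ * p t) (fun t ht => ((hXm t ht).mul_const _).aestronglyMeasurable)
    hZm.aestronglyMeasurable (by simpa using hr.const_mul σ)
    (by simpa [mul_left_comm] using hrt.const_mul σ) hD hbound hlim
  obtain ⟨v, hv, hlaw⟩ := hB.exists_map_integral_eq h
  have hσc : 0 < σ / (2 * c) := by positivity
  refine ⟨fun ω => Z ω / c, hZm.div_const c,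
    ⟨(ψ 0 * p 0 + q 0 * Ψ) / (2 * c), NNReal.mk _ (sq_nonneg (σ / (2 * c))) * v, ?_, ?_⟩, ?_, ?_, ?_⟩
  · exact mul_pos (pow_pos hσc 2 : (0 : ℝ) < (σ / (2 * c)) ^ 2) hv
  · have h1 := gaussianReal_add_const (gaussianReal_const_mul ⟨hYm.aemeasurable, hlaw⟩
      (σ / (2 * c))) ((ψ 0 * p 0 + q 0 * Ψ) / (2 * c))
    have e : (fun ω => Z ω / c)
        = fun ω => σ / (2 * c) * Y ω + (ψ 0 * p 0 + q 0 * Ψ) / (2 * c) := by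
      ext ω; simp only [hZ]; field_simp; ring
    rw [e]
    simpa using h1.map_eq
  · filter_upwards [hlim, hB.ae_exists_abs_le] with ω h1 ⟨M, hM⟩
    have h2 := h1.add ((h.tendsto_mul_p hM).const_mul σ)
    rw [mul_zero, add_zero] at h2
    refine (h2.div h.tendsto_p hc.ne').congr' ?_
    filter_upwards [eventually_ge_atTop 0] with t ht
    have := h.p_pos t ht
    have e : X t ω * p t - B t ω * (σ * p t) + σ * (B t ω * p t) = p t * X t ω := by ring
    simp only [Pi.div_apply, e]
    exact mul_div_mul_left _ _ this.ne'
  · rw [integral_div]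
    refine (hmean.div h.tendsto_p hc.ne').congr' ?_
    filter_upwards [eventually_ge_atTop 0] with t ht
    have := h.p_pos t ht
    simp only [Pi.div_apply, integral_mul_const, mul_comm _ (p t)]
    exact mul_div_mul_left _ _ this.ne'
  · have e : variance (fun ω => Z ω / c) P = variance Z P / c ^ 2 := by
      simp only [div_eq_mul_inv, variance_mul_const, inv_pow]
    rw [e]
    refine (hvar.div (h.tendsto_p.pow 2) (by positivity)).congr' ?_
    filter_upwards [eventually_gt_atTop 0] with t ht
    have := h.p_pos t ht.le
    have e1 : (t ^ (-(1:ℝ) / 4)) ^ 2 = t ^ (-(1:ℝ) / 2) := by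
      rw [← Real.rpow_natCast, ← Real.rpow_mul ht.le]
      norm_num
    have e2 : Real.exp (2 * √(b * t)) ^ 2 = Real.exp (4 * √(b * t)) := by
      rw [← Real.exp_nat_mul]
      congr 1
      push_cast
      ring
    simp only [Pi.div_apply, variance_mul_const, mul_comm _ (p t ^ 2), mul_pow, e1, e2]
    exact mul_div_mul_left _ _ (by positivity)
end
end

section
/- Fix t ≥ 0 and define γ_t(Δ) := σ² ∫_0^t r(t,s) r(t+Δ,s) ds for Δ ≥ −t. Then: (1) for every Δ ≥ 0, γ_t is differentiable at Δ with γ_t'(Δ) = a γ_t(Δ) + ( b/(1+t+Δ) ) ∫_{−t}^{Δ} γ_t(w) dw; and (2) for every Δ with −t ≤ Δ < 0, γ_t'(Δ) = a γ_t(Δ) + ( b/(1+t+Δ) ) ∫_{−t}^{Δ} γ_t(w) dw + σ² r(t, t+Δ). -/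
open MeasureTheory Filter Real Set
open scoped Topology

noncomputable section

lemma intervalIntegrable_of_measurable_of_bounded {f : ℝ → ℝ} (hf : Measurable f) {c d C : ℝ}
    (h : ∀ x ∈ uIoc c d, |f x| ≤ C) : IntervalIntegrable f volume c d := by
  rw [intervalIntegrable_iff]
  exact Measure.integrableOn_of_bounded (by simp [uIoc]) hf.aestronglyMeasurable
    ((ae_restrict_iff' measurableSet_uIoc).2 (ae_of_all _ h))

lemma intervalIntegral_swap_of_bounded {F : ℝ → ℝ → ℝ} (hF : Measurable (Function.uncurry F))
    {c d c' d' C : ℝ} (h : ∀ x ∈ uIoc c d, ∀ y ∈ uIoc c' d', |F x y| ≤ C) :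
    ∫ x in c..d, ∫ y in c'..d', F x y = ∫ y in c'..d', ∫ x in c..d, F x y := by
  refine intervalIntegral_intervalIntegral_swap ?_
  rw [Measure.volume_eq_prod]
  refine Measure.integrableOn_of_bounded (M := C) ?_ hF.aestronglyMeasurable ?_
  · rw [Measure.prod_prod]
    exact ENNReal.mul_ne_top (by simp [uIoc]) (by simp [uIoc])
  · exact (ae_restrict_iff' (measurableSet_uIoc.prod measurableSet_uIoc)).2
      (ae_of_all _ fun p hp => h _ hp.1 _ hp.2)

lemma abs_div_one_add_le {b v : ℝ} (hv : 0 ≤ v) : |b / (1 + v)| ≤ |b| := by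
  rw [abs_div, abs_of_pos (by linarith : (0 : ℝ) < 1 + v)]
  exact div_le_self (abs_nonneg b) (by linarith)

lemma norm_averageField_le {a b v x y : ℝ} (hv : 0 ≤ v) :
    ‖(y, a * y + b / (1 + v) * x)‖ ≤ (1 + |a| + |b|) * ‖(x, y)‖ := by
  have h1 : |x| ≤ ‖(x, y)‖ := norm_fst_le (x, y)
  have h2 : |y| ≤ ‖(x, y)‖ := norm_snd_le (x, y)
  have h4 : |a * y| ≤ |a| * ‖(x, y)‖ := by
    rw [abs_mul]; gcongr
  have h5 : |b / (1 + v) * x| ≤ |b| * ‖(x, y)‖ := by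
    rw [abs_mul]
    exact mul_le_mul (abs_div_one_add_le hv) h1 (abs_nonneg x) (abs_nonneg b)
  have h6 := abs_nonneg a
  have h7 := abs_nonneg b
  have h8 := norm_nonneg (x, y)
  refine norm_prod_le_iff.2 ⟨?_, ?_⟩ <;> simp only [Real.norm_eq_abs]
  · nlinarith [mul_nonneg h6 h8, mul_nonneg h7 h8]
  · have := abs_add_le (a * y) (b / (1 + v) * x)
    nlinarith

/-- Growth bound for the planar linear system `x' = y`, `y' = a y + b / (1 + t) x`. -/
lemma norm_le_exp_of_averageSystem {a b c : ℝ} (hc : 0 ≤ c) {x y : ℝ → ℝ}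
    (hx : ∀ t, c ≤ t → HasDerivWithinAt x (y t) (Ici c) t)
    (hy : ∀ t, c ≤ t → HasDerivWithinAt y (a * y t + b / (1 + t) * x t) (Ici c) t)
    {t : ℝ} (ht : c ≤ t) :
    ‖(x t, y t)‖ ≤ ‖(x c, y c)‖ * exp ((1 + |a| + |b|) * (t - c)) := by
  have hd : ∀ v, c ≤ v → HasDerivWithinAt (fun v => (x v, y v))
      (y v, a * y v + b / (1 + v) * x v) (Ici c) v := fun v hv => (hx v hv).prodMk (hy v hv)
  have := norm_le_gronwallBound_of_norm_deriv_right_le (f := fun v => (x v, y v))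
    (f' := fun v => (y v, a * y v + b / (1 + v) * x v)) (δ := ‖(x c, y c)‖)
    (K := 1 + |a| + |b|) (ε := 0) (a := c) (b := t)
    (fun v hv => ((hd v hv.1).continuousWithinAt).mono Icc_subset_Ici_self)
    (fun v hv => (hd v hv.1).mono (Ici_subset_Ici.2 hv.1)) le_rfl
    (fun v hv => by rw [add_zero]; exact norm_averageField_le (hc.trans hv.1)) t ⟨ht, le_rfl⟩
  rwa [gronwallBound_ε0] at this

lemma hasDerivWithinAt_integral_Ici {f : ℝ → ℝ} {c t : ℝ} (hf : ContinuousOn f (Ici c))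
    (ht : c ≤ t) : HasDerivWithinAt (fun τ => ∫ u in c..τ, f u) (f t) (Ici c) t := by
  have hg : Continuous fun u => f (max c u) :=
    hf.comp_continuous (by fun_prop) fun u => le_max_left c u
  have h := (hg.integral_hasStrictDerivAt c t).hasDerivAt.hasDerivWithinAt (s := Ici c)
  have heq : ∀ τ ∈ Ici c, ∫ u in c..τ, f u = ∫ u in c..τ, f (max c u) := fun τ hτ =>
    intervalIntegral.integral_congr fun u hu => by
      rw [uIcc_of_le hτ] at hu
      simp only [max_eq_right hu.1]
  rw [max_eq_right ht] at h
  exact h.congr heq (heq t ht)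

/-- `r` is the differential resolvent of the equation with average functional. -/
structure IsAverageResolvent (a b : ℝ) (r : ℝ → ℝ → ℝ) : Prop where
  eq_zero : ∀ s : ℝ, 0 ≤ s → ∀ t : ℝ, 0 ≤ t → t < s → r t s = 0
  eq_one : ∀ s : ℝ, 0 ≤ s → r s s = 1
  hasDerivWithinAt : ∀ s : ℝ, 0 ≤ s → ∀ t : ℝ, s ≤ t →
    HasDerivWithinAt (fun τ => r τ s)
      (a * r t s + b / (1 + t) * ∫ u in s..t, r u s) (Ici s) t

namespace IsAverageResolvent

variable {a b : ℝ} {r : ℝ → ℝ → ℝ}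

lemma continuousOn (hr : IsAverageResolvent a b r) {s : ℝ} (hs : 0 ≤ s) :
    ContinuousOn (fun τ => r τ s) (Ici s) :=
  fun t ht => (hr.hasDerivWithinAt s hs t ht).continuousWithinAt

lemma hasDerivWithinAt_integral (hr : IsAverageResolvent a b r) {s t : ℝ} (hs : 0 ≤ s)
    (ht : s ≤ t) : HasDerivWithinAt (fun τ => ∫ u in s..τ, r u s) (r t s) (Ici s) t :=
  hasDerivWithinAt_integral_Ici (hr.continuousOn hs) ht

lemma norm_le_exp (hr : IsAverageResolvent a b r) {s t T : ℝ} (hs : 0 ≤ s) (ht : s ≤ t)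
    (hT : t ≤ T) : ‖(∫ u in s..t, r u s, r t s)‖ ≤ exp ((1 + |a| + |b|) * T) := by
  have h := norm_le_exp_of_averageSystem hs
    (fun t ht => hr.hasDerivWithinAt_integral hs ht) (hr.hasDerivWithinAt s hs) ht
  simp only [intervalIntegral.integral_same, hr.eq_one s hs] at h
  have h1 : ‖((0 : ℝ), (1 : ℝ))‖ = 1 := by simp [Prod.norm_def]
  rw [h1, one_mul] at h
  refine h.trans (exp_le_exp.2 ?_)
  gcongr
  linarith

lemma norm_sub_le_fst (hr : IsAverageResolvent a b r) {s t t' T : ℝ} (hs : 0 ≤ s)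
    (ht : s ≤ t) (ht' : s ≤ t') (hT : t ≤ T) (hT' : t' ≤ T) :
    ‖(∫ u in s..t, r u s, r t s) - (∫ u in s..t', r u s, r t' s)‖ ≤
      (1 + |a| + |b|) * exp ((1 + |a| + |b|) * T) * |t - t'| := by
  refine Convex.norm_image_sub_le_of_norm_hasDerivWithin_le
    (f := fun t => (∫ u in s..t, r u s, r t s))
    (f' := fun t => (r t s, a * r t s + b / (1 + t) * ∫ u in s..t, r u s)) (s := Icc s T)
    (fun v hv => ((hr.hasDerivWithinAt_integral hs hv.1).prodMk
      (hr.hasDerivWithinAt s hs v hv.1)).mono Icc_subset_Ici_self)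
    (fun v hv => ?_) (convex_Icc s T) ⟨ht', hT'⟩ ⟨ht, hT⟩
  refine (norm_averageField_le (hs.trans hv.1)).trans ?_
  gcongr
  exact hr.norm_le_exp hs hv.1 hv.2

lemma abs_sub_le_fst (hr : IsAverageResolvent a b r) {s t t' T : ℝ} (hs : 0 ≤ s)
    (ht : s ≤ t) (ht' : s ≤ t') (hT : t ≤ T) (hT' : t' ≤ T) :
    |r t s - r t' s| ≤ (1 + |a| + |b|) * exp ((1 + |a| + |b|) * T) * |t - t'| :=
  (norm_snd_le ((∫ u in s..t, r u s, r t s) - (∫ u in s..t', r u s, r t' s))).trans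
    (hr.norm_sub_le_fst hs ht ht' hT hT')

lemma abs_sub_le_snd_of_le (hr : IsAverageResolvent a b r) {s s' t T : ℝ} (hs : 0 ≤ s)
    (hss : s ≤ s') (ht : s' ≤ t) (hT : t ≤ T) :
    |r t s - r t s'| ≤ (1 + |a| + |b|) * exp ((1 + |a| + |b|) * T) *
      exp ((1 + |a| + |b|) * T) * |s - s'| := by
  have hs' := hs.trans hss
  have h := norm_le_exp_of_averageSystem (a := a) (b := b) (c := s')
    (x := fun t => (∫ u in s..t, r u s) - ∫ u in s'..t, r u s')
    (y := fun t => r t s - r t s') hs'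
    (fun v hv => ((hr.hasDerivWithinAt_integral hs (hss.trans hv)).mono
      (Ici_subset_Ici.2 hss)).sub (hr.hasDerivWithinAt_integral hs' hv))
    (fun v hv => (((hr.hasDerivWithinAt s hs v (hss.trans hv)).mono
      (Ici_subset_Ici.2 hss)).sub (hr.hasDerivWithinAt s' hs' v hv)).congr_deriv (by ring)) ht
  have h0 := hr.norm_sub_le_fst hs hss le_rfl (ht.trans hT) (hss.trans (ht.trans hT))
  simp only [intervalIntegral.integral_same, hr.eq_one s hs, hr.eq_one s' hs', Prod.mk_sub_mk]
    at h h0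
  calc |r t s - r t s'| ≤ _ := (norm_snd_le (_, r t s - r t s')).trans h
    _ ≤ (1 + |a| + |b|) * exp ((1 + |a| + |b|) * T) * |s' - s| *
      exp ((1 + |a| + |b|) * T) := by
        gcongr
        linarith
    _ = _ := by rw [abs_sub_comm]; ring

lemma abs_sub_le_snd (hr : IsAverageResolvent a b r) {s s' t T : ℝ} (hs : 0 ≤ s)
    (hs' : 0 ≤ s') (ht : s ≤ t) (ht' : s' ≤ t) (hT : t ≤ T) :
    |r t s - r t s'| ≤ (1 + |a| + |b|) * exp ((1 + |a| + |b|) * T) *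
      exp ((1 + |a| + |b|) * T) * |s - s'| := by
  rcases le_total s s' with h | h
  · exact hr.abs_sub_le_snd_of_le hs h ht' hT
  · rw [abs_sub_comm, abs_sub_comm s]
    exact hr.abs_sub_le_snd_of_le hs' h ht hT

lemma continuousOn_uncurry (hr : IsAverageResolvent a b r) :
    ContinuousOn (Function.uncurry r) {p | 0 ≤ p.2 ∧ p.2 ≤ p.1} := by
  rintro ⟨t, s⟩ ⟨hs, hst⟩
  simp only at hs hst
  set L := (1 + |a| + |b|) * exp ((1 + |a| + |b|) * (t + 1)) with hL
  set L' := L * exp ((1 + |a| + |b|) * (t + 1)) with hL'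
  refine tendsto_iff_dist_tendsto_zero.2 ?_
  have hlim : Tendsto (fun p : ℝ × ℝ => L * |p.1 - max t p.1| + L' * |p.2 - s| +
      L * |max t p.1 - t|) (𝓝[{p | 0 ≤ p.2 ∧ p.2 ≤ p.1}] (t, s)) (𝓝 0) := by
    have : Continuous fun p : ℝ × ℝ => L * |p.1 - max t p.1| + L' * |p.2 - s| +
      L * |max t p.1 - t| := by fun_prop
    simpa using (this.tendsto (t, s)).mono_left nhdsWithin_le_nhds
  refine squeeze_zero' (Eventually.of_forall fun p => dist_nonneg) ?_ hlim
  have hev : ∀ᶠ p : ℝ × ℝ in 𝓝[{p | 0 ≤ p.2 ∧ p.2 ≤ p.1}] (t, s), p.1 < t + 1 :=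
    nhdsWithin_le_nhds (continuous_fst.continuousAt.eventually_lt_const (by simp))
  filter_upwards [hev, self_mem_nhdsWithin] with p hp hpS
  have hm : max t p.1 ≤ t + 1 := max_le (by linarith) hp.le
  have h1 := hr.abs_sub_le_fst hpS.1 hpS.2 (hpS.2.trans (le_max_right t p.1)) hp.le hm
  have h2 := hr.abs_sub_le_snd hpS.1 hs (hpS.2.trans (le_max_right t p.1))
    (hst.trans (le_max_left t p.1)) hm
  have h3 := hr.abs_sub_le_fst hs (hst.trans (le_max_left t p.1)) hst hm (by linarith)
  rw [Real.dist_eq]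
  have e : Function.uncurry r p - Function.uncurry r (t, s) = (r p.1 p.2 - r (max t p.1) p.2) +
    (r (max t p.1) p.2 - r (max t p.1) s) + (r (max t p.1) s - r t s) := by
      simp [Function.uncurry]
  rw [e]
  exact (abs_add_three _ _ _).trans (add_le_add (add_le_add h1 h2) h3)

end IsAverageResolvent

/-- The kernel `r` restricted to `0 ≤ s ≤ t` and extended by zero. -/
def causalKernel (r : ℝ → ℝ → ℝ) (t s : ℝ) : ℝ := if 0 ≤ s ∧ s ≤ t then r t s else 0

lemma causalKernel_of_le {r : ℝ → ℝ → ℝ} {s t : ℝ} (hs : 0 ≤ s) (ht : s ≤ t) :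
    causalKernel r t s = r t s := if_pos ⟨hs, ht⟩

lemma causalKernel_of_lt {r : ℝ → ℝ → ℝ} {s t : ℝ} (ht : t < s) : causalKernel r t s = 0 :=
  if_neg fun h => ht.not_ge h.2

lemma integral_causalKernel_of_le {r : ℝ → ℝ → ℝ} {s v : ℝ} (hv : 0 ≤ v) (hvs : v ≤ s) :
    ∫ u in (0 : ℝ)..v, causalKernel r u s = 0 := by
  rw [intervalIntegral.integral_congr_Ioo_of_le (g := fun _ => (0 : ℝ)) hv
    fun u hu => causalKernel_of_lt (hu.2.trans_le hvs)]
  simp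

namespace IsAverageResolvent

variable {a b : ℝ} {r : ℝ → ℝ → ℝ}

lemma causalKernel_eq (hr : IsAverageResolvent a b r) {s t : ℝ} (hs : 0 ≤ s) (ht : 0 ≤ t) :
    causalKernel r t s = r t s := by
  rcases le_or_gt s t with h | h
  · exact causalKernel_of_le hs h
  · rw [causalKernel_of_lt h, hr.eq_zero s hs t ht h]

lemma measurable_causalKernel (hr : IsAverageResolvent a b r) :
    Measurable (Function.uncurry (causalKernel r)) := by
  classical
  have hS : MeasurableSet {p : ℝ × ℝ | 0 ≤ p.2 ∧ p.2 ≤ p.1} :=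
    (measurableSet_le measurable_const measurable_snd).inter
      (measurableSet_le measurable_snd measurable_fst)
  convert hr.continuousOn_uncurry.measurable_piecewise (continuousOn_const (c := (0 : ℝ))) hS
    using 1
  ext p
  simp [causalKernel, Function.uncurry, Set.piecewise]

lemma abs_causalKernel_le (hr : IsAverageResolvent a b r) {s t T : ℝ} (hT : t ≤ T) :
    |causalKernel r t s| ≤ exp ((1 + |a| + |b|) * T) := by
  unfold causalKernel
  split_ifs with h
  · exact (norm_snd_le (∫ u in s..t, r u s, r t s)).trans (hr.norm_le_exp h.1 h.2 hT)
  · simpa using (exp_pos _).le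

lemma intervalIntegrable_causalKernel (hr : IsAverageResolvent a b r) (s c d : ℝ) :
    IntervalIntegrable (fun u => causalKernel r u s) volume c d :=
  intervalIntegrable_of_measurable_of_bounded
    (hr.measurable_causalKernel.comp (measurable_id.prodMk measurable_const))
    fun _ hx => hr.abs_causalKernel_le (T := max c d) hx.2

lemma integral_causalKernel_of_ge (hr : IsAverageResolvent a b r) {s v : ℝ} (hs : 0 ≤ s)
    (hv : s ≤ v) : ∫ u in (0 : ℝ)..v, causalKernel r u s = ∫ u in s..v, r u s := by
  rw [← intervalIntegral.integral_add_adjacent_intervals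
    (hr.intervalIntegrable_causalKernel s 0 s) (hr.intervalIntegrable_causalKernel s s v),
    integral_causalKernel_of_le hs le_rfl, zero_add]
  refine intervalIntegral.integral_congr fun u hu => ?_
  rw [uIcc_of_le hv] at hu
  exact causalKernel_of_le hs hu.1

lemma abs_integral_causalKernel_le (hr : IsAverageResolvent a b r) {s v T : ℝ} (hv : 0 ≤ v)
    (hT : v ≤ T) :
    |∫ u in (0 : ℝ)..v, causalKernel r u s| ≤ exp ((1 + |a| + |b|) * T) * T := by
  refine (intervalIntegral.norm_integral_le_of_norm_le_const (E := ℝ)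
    (C := exp ((1 + |a| + |b|) * T)) fun u hu => ?_).trans ?_
  · rw [uIoc_of_le hv] at hu
    exact hr.abs_causalKernel_le (hu.2.trans hT)
  · rw [sub_zero, abs_of_nonneg hv]
    gcongr

lemma measurable_integral_causalKernel (hr : IsAverageResolvent a b r) :
    Measurable (Function.uncurry fun v s => ∫ u in (0 : ℝ)..v, causalKernel r u s) := by
  refine measurable_uncurry_of_continuous_of_measurable
    (fun s => intervalIntegral.continuous_primitive (E := ℝ) (μ := volume)
      (hr.intervalIntegrable_causalKernel s) 0) fun v => ?_
  have h : StronglyMeasurable fun p : ℝ × ℝ => causalKernel r p.2 p.1 :=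
    (hr.measurable_causalKernel.comp measurable_swap).stronglyMeasurable
  simp only [intervalIntegral]
  exact (h.integral_prod_right'.sub h.integral_prod_right').measurable

/-- Integrated form of the resolvent equation, valid on both sides of the diagonal. -/
lemma causalKernel_eq_integral (hr : IsAverageResolvent a b r) {s τ : ℝ} (hs : 0 ≤ s)
    (hτ : 0 ≤ τ) :
    causalKernel r τ s = (if s ≤ τ then 1 else 0) + ∫ v in (0 : ℝ)..τ,
      (a * causalKernel r v s + b / (1 + v) * ∫ u in (0 : ℝ)..v, causalKernel r u s) := by
  have hzero : ∀ τ, 0 ≤ τ → τ ≤ s → ∫ v in (0 : ℝ)..τ,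
      (a * causalKernel r v s + b / (1 + v) * ∫ u in (0 : ℝ)..v, causalKernel r u s) = 0 := by
    intro τ hτ hτs
    rw [intervalIntegral.integral_congr_Ioo_of_le (g := fun _ => (0 : ℝ)) hτ fun v hv => by
      simp only [causalKernel_of_lt (hv.2.trans_le hτs),
        integral_causalKernel_of_le hv.1.le (hv.2.le.trans hτs), mul_zero, add_zero]]
    simp
  split_ifs with h
  · have hcont : ContinuousOn (fun v => a * r v s + b / (1 + v) * ∫ u in s..v, r u s)
        (Ici s) := by
      refine (continuousOn_const.mul (hr.continuousOn hs)).add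
        ((continuousOn_const.div (by fun_prop) fun v hv => ?_).mul
          fun v hv => (hr.hasDerivWithinAt_integral hs hv).continuousWithinAt)
      have : s ≤ v := hv
      linarith
    have hsub : uIcc s τ ⊆ Ici s := by rw [uIcc_of_le h]; exact Icc_subset_Ici_self
    have hftc := intervalIntegral.integral_eq_sub_of_hasDeriv_right
      ((hr.continuousOn hs).mono hsub)
      (fun v hv => by
        rw [min_eq_left h] at hv
        exact (hr.hasDerivWithinAt s hs v hv.1.le).mono
          (Ioi_subset_Ici_self.trans (Ici_subset_Ici.2 hv.1.le)))
      (hcont.mono hsub).intervalIntegrable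
    have hcongr : EqOn (fun v => a * r v s + b / (1 + v) * ∫ u in s..v, r u s)
        (fun v => a * causalKernel r v s + b / (1 + v) * ∫ u in (0 : ℝ)..v, causalKernel r u s)
        (uIcc s τ) := fun v hv => by
      simp only [causalKernel_of_le hs (hsub hv), hr.integral_causalKernel_of_ge hs (hsub hv)]
    have hint : ∀ c d, 0 ≤ c → c ≤ d → IntervalIntegrable (fun v => a * causalKernel r v s +
        b / (1 + v) * ∫ u in (0 : ℝ)..v, causalKernel r u s) volume c d := fun c d hc hcd =>
      ((hr.intervalIntegrable_causalKernel s c d).const_mul a).add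
        ((intervalIntegral.continuous_primitive
          (fun c d => hr.intervalIntegrable_causalKernel s c d) 0).intervalIntegrable c d
          |>.continuousOn_mul (continuousOn_const.div (by fun_prop) fun v hv => by
            rw [uIcc_of_le hcd] at hv
            linarith [hv.1]))
    rw [← intervalIntegral.integral_add_adjacent_intervals (hint 0 s le_rfl hs)
      (hint s τ hs h), hzero s hs le_rfl, ← intervalIntegral.integral_congr hcongr, hftc,
      causalKernel_of_le hs h, hr.eq_one s hs]
    ring
  · rw [hzero τ hτ (le_of_not_ge h), causalKernel_of_lt (lt_of_not_ge h), zero_add]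

end IsAverageResolvent

/-- The unnormalised autocovariance `∫₀ᵗ r(t, s) r(τ, s) ds`, in terms of the causal kernel. -/
def crossCorrelation (r : ℝ → ℝ → ℝ) (t τ : ℝ) : ℝ :=
  ∫ s in (0 : ℝ)..t, causalKernel r t s * causalKernel r τ s

namespace IsAverageResolvent

variable {a b : ℝ} {r : ℝ → ℝ → ℝ}

lemma measurable_causalKernel_right (hr : IsAverageResolvent a b r) (t : ℝ) :
    Measurable (causalKernel r t) :=
  hr.measurable_causalKernel.comp (measurable_const.prodMk measurable_id)

lemma measurable_crossCorrelation (hr : IsAverageResolvent a b r) (t : ℝ) :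
    Measurable (crossCorrelation r t) := by
  have h : StronglyMeasurable fun p : ℝ × ℝ => causalKernel r t p.2 * causalKernel r p.1 p.2 :=
    (((hr.measurable_causalKernel_right t).comp measurable_snd).mul
      hr.measurable_causalKernel).stronglyMeasurable
  unfold crossCorrelation
  simp only [intervalIntegral]
  exact (h.integral_prod_right'.sub h.integral_prod_right').measurable

lemma abs_crossCorrelation_le (hr : IsAverageResolvent a b r) {t τ T : ℝ} (ht : 0 ≤ t)
    (hT : τ ≤ T) :
    |crossCorrelation r t τ| ≤
      exp ((1 + |a| + |b|) * t) * exp ((1 + |a| + |b|) * T) * t := by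
  refine (intervalIntegral.norm_integral_le_of_norm_le_const (E := ℝ)
    (C := exp ((1 + |a| + |b|) * t) * exp ((1 + |a| + |b|) * T)) fun u hu => ?_).trans ?_
  · rw [norm_mul]
    exact mul_le_mul (hr.abs_causalKernel_le le_rfl) (hr.abs_causalKernel_le hT)
      (norm_nonneg _) (exp_pos _).le
  · rw [sub_zero, abs_of_nonneg ht]

lemma intervalIntegrable_crossCorrelation (hr : IsAverageResolvent a b r) {t : ℝ} (ht : 0 ≤ t)
    (c d : ℝ) : IntervalIntegrable (crossCorrelation r t) volume c d :=
  intervalIntegrable_of_measurable_of_bounded (hr.measurable_crossCorrelation t)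
    fun _ hx => hr.abs_crossCorrelation_le ht (T := max c d) hx.2

lemma intervalIntegrable_causalKernel_mul (hr : IsAverageResolvent a b r) (t : ℝ) {g : ℝ → ℝ}
    (hg : Measurable g) {C : ℝ} (hC : ∀ s, |g s| ≤ C) (c d : ℝ) :
    IntervalIntegrable (fun s => causalKernel r t s * g s) volume c d :=
  intervalIntegrable_of_measurable_of_bounded ((hr.measurable_causalKernel_right t).mul hg)
    (C := exp ((1 + |a| + |b|) * t) * C) fun s _ => by
      rw [Pi.mul_apply, abs_mul]
      exact mul_le_mul (hr.abs_causalKernel_le le_rfl) (hC s) (abs_nonneg _) (exp_pos _).le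

lemma integral_causalKernel_mul_field (hr : IsAverageResolvent a b r) (t : ℝ) {v : ℝ}
    (hv : 0 ≤ v) :
    ∫ s in (0 : ℝ)..t, causalKernel r t s *
      (a * causalKernel r v s + b / (1 + v) * ∫ u in (0 : ℝ)..v, causalKernel r u s) =
    a * crossCorrelation r t v + b / (1 + v) * ∫ u in (0 : ℝ)..v, crossCorrelation r t u := by
  have h1 := hr.intervalIntegrable_causalKernel_mul t (hr.measurable_causalKernel_right v)
    (fun s => hr.abs_causalKernel_le le_rfl) 0 t
  have h2 := hr.intervalIntegrable_causalKernel_mul t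
    (g := fun s => ∫ u in (0 : ℝ)..v, causalKernel r u s)
    (hr.measurable_integral_causalKernel.comp (measurable_const.prodMk measurable_id))
    (fun s => hr.abs_integral_causalKernel_le hv le_rfl) 0 t
  have hswap : ∫ u in (0 : ℝ)..v, crossCorrelation r t u = ∫ s in (0 : ℝ)..t,
      causalKernel r t s * ∫ u in (0 : ℝ)..v, causalKernel r u s := by
    unfold crossCorrelation
    rw [intervalIntegral_swap_of_bounded
      (F := fun u s => causalKernel r t s * causalKernel r u s)
      (C := exp ((1 + |a| + |b|) * t) * exp ((1 + |a| + |b|) * v))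
      (((hr.measurable_causalKernel_right t).comp measurable_snd).mul
        hr.measurable_causalKernel)]
    · simp only [intervalIntegral.integral_const_mul]
    · intro u hu s _
      rw [uIoc_of_le hv] at hu
      rw [abs_mul]
      exact mul_le_mul (hr.abs_causalKernel_le le_rfl) (hr.abs_causalKernel_le hu.2)
        (abs_nonneg _) (exp_pos _).le
  rw [hswap, crossCorrelation, ← intervalIntegral.integral_const_mul,
    ← intervalIntegral.integral_const_mul,
    ← intervalIntegral.integral_add (h1.const_mul a) (h2.const_mul _)]
  exact intervalIntegral.integral_congr fun s _ => by ring

lemma abs_field_le (hr : IsAverageResolvent a b r) {v s T : ℝ} (hv : 0 ≤ v) (hT : v ≤ T) :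
    |a * causalKernel r v s + b / (1 + v) * ∫ u in (0 : ℝ)..v, causalKernel r u s| ≤
      |a| * exp ((1 + |a| + |b|) * T) + |b| * (exp ((1 + |a| + |b|) * T) * T) := by
  refine (abs_add_le _ _).trans (add_le_add ?_ ?_) <;> rw [abs_mul]
  · gcongr
    exact hr.abs_causalKernel_le hT
  · exact mul_le_mul (abs_div_one_add_le hv) (hr.abs_integral_causalKernel_le hv hT)
      (abs_nonneg _) (abs_nonneg b)

lemma crossCorrelation_eq (hr : IsAverageResolvent a b r) {t τ : ℝ} (ht : 0 ≤ t)
    (hτ : 0 ≤ τ) :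
    crossCorrelation r t τ = (∫ s in (0 : ℝ)..min t τ, r t s) + ∫ v in (0 : ℝ)..τ,
      (a * crossCorrelation r t v +
        b / (1 + v) * ∫ u in (0 : ℝ)..v, crossCorrelation r t u) := by
  have hF : Measurable (Function.uncurry fun v s => causalKernel r t s *
      (a * causalKernel r v s + b / (1 + v) * ∫ u in (0 : ℝ)..v, causalKernel r u s)) :=
    ((hr.measurable_causalKernel_right t).comp measurable_snd).mul
      ((hr.measurable_causalKernel.const_mul a).add
        ((measurable_const.div (measurable_const.add measurable_fst)).mul
          hr.measurable_integral_causalKernel))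
  have hbd : ∀ v ∈ uIoc 0 τ, ∀ s, |causalKernel r t s *
      (a * causalKernel r v s + b / (1 + v) * ∫ u in (0 : ℝ)..v, causalKernel r u s)| ≤
      exp ((1 + |a| + |b|) * t) *
        (|a| * exp ((1 + |a| + |b|) * τ) + |b| * (exp ((1 + |a| + |b|) * τ) * τ)) := by
    intro v hv s
    rw [uIoc_of_le hτ] at hv
    rw [abs_mul]
    exact mul_le_mul (hr.abs_causalKernel_le le_rfl) (hr.abs_field_le hv.1.le hv.2)
      (abs_nonneg _) (exp_pos _).le
  have hswap := intervalIntegral_swap_of_bounded hF (c' := 0) (d' := t)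
    fun v hv s _ => hbd v hv s
  have hind : Measurable fun s : ℝ => if s ≤ τ then (1 : ℝ) else 0 :=
    Measurable.ite measurableSet_Iic measurable_const measurable_const
  have h1 := hr.intervalIntegrable_causalKernel_mul t hind (C := 1)
    (fun s => by split_ifs <;> simp) 0 t
  have h2 : IntervalIntegrable (fun s => ∫ v in (0 : ℝ)..τ, causalKernel r t s *
      (a * causalKernel r v s + b / (1 + v) * ∫ u in (0 : ℝ)..v, causalKernel r u s))
      volume 0 t := by
    have h : StronglyMeasurable fun p : ℝ × ℝ => causalKernel r t p.1 *
        (a * causalKernel r p.2 p.1 +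
          b / (1 + p.2) * ∫ u in (0 : ℝ)..p.2, causalKernel r u p.1) :=
      (hF.comp measurable_swap).stronglyMeasurable
    refine intervalIntegrable_of_measurable_of_bounded ?_ fun s _ =>
      intervalIntegral.norm_integral_le_of_norm_le_const (E := ℝ) fun v hv => hbd v hv s
    simp only [intervalIntegral]
    exact (h.integral_prod_right'.sub h.integral_prod_right').measurable
  have hmin : ∫ s in (0 : ℝ)..t, causalKernel r t s * (if s ≤ τ then (1 : ℝ) else 0) =
      ∫ s in (0 : ℝ)..min t τ, r t s := by
    rw [← intervalIntegral.integral_indicator (a₃ := t) ⟨le_min ht hτ, min_le_left t τ⟩]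
    refine intervalIntegral.integral_congr fun s hs => ?_
    rw [uIcc_of_le ht] at hs
    by_cases h : s ≤ τ <;> simp [indicator, causalKernel_of_le hs.1 hs.2, h, hs.2]
  have hfield : ∫ v in (0 : ℝ)..τ, (a * crossCorrelation r t v +
        b / (1 + v) * ∫ u in (0 : ℝ)..v, crossCorrelation r t u) =
      ∫ v in (0 : ℝ)..τ, ∫ s in (0 : ℝ)..t, causalKernel r t s *
        (a * causalKernel r v s + b / (1 + v) * ∫ u in (0 : ℝ)..v, causalKernel r u s) :=
    intervalIntegral.integral_congr fun v hv => by
      rw [uIcc_of_le hτ] at hv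
      exact (hr.integral_causalKernel_mul_field t hv.1).symm
  rw [hfield, hswap, ← hmin, ← intervalIntegral.integral_add h1 h2, crossCorrelation]
  refine intervalIntegral.integral_congr fun s hs => ?_
  rw [uIcc_of_le ht] at hs
  simp only [intervalIntegral.integral_const_mul]
  rw [hr.causalKernel_eq_integral hs.1 hτ, mul_add]

lemma continuousOn_snd (hr : IsAverageResolvent a b r) (t : ℝ) :
    ContinuousOn (r t) (Icc 0 t) :=
  hr.continuousOn_uncurry.comp (f := fun s => (t, s)) (by fun_prop) fun _ hs => hs

lemma intervalIntegrable_field (hr : IsAverageResolvent a b r) {t τ : ℝ} (ht : 0 ≤ t)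
    (hτ : 0 ≤ τ) : IntervalIntegrable (fun v => a * crossCorrelation r t v +
      b / (1 + v) * ∫ u in (0 : ℝ)..v, crossCorrelation r t u) volume 0 τ :=
  ((hr.intervalIntegrable_crossCorrelation ht 0 τ).const_mul a).add
    ((intervalIntegral.continuous_primitive
      (hr.intervalIntegrable_crossCorrelation ht) 0).intervalIntegrable 0 τ
      |>.continuousOn_mul (continuousOn_const.div (by fun_prop) fun v hv => by
        rw [uIcc_of_le hτ] at hv
        linarith [hv.1]))

lemma continuousOn_crossCorrelation (hr : IsAverageResolvent a b r) {t : ℝ} (ht : 0 ≤ t) :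
    ContinuousOn (crossCorrelation r t) (Ici 0) := by
  intro τ hτ
  have hτ : 0 ≤ τ := hτ
  have hτ1 : (0 : ℝ) ≤ τ + 1 := by linarith
  have hcont : ContinuousOn (crossCorrelation r t) (Icc 0 (τ + 1)) := by
    refine ContinuousOn.congr (ContinuousOn.add ?_ ?_)
      fun v hv => hr.crossCorrelation_eq ht hv.1
    · have h := intervalIntegral.continuousOn_primitive_interval (a := 0) (b := t)
        (μ := volume) (f := r t) (by
          rw [uIcc_of_le ht]
          exact (hr.continuousOn_snd t).integrableOn_Icc)
      rw [uIcc_of_le ht] at h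
      exact h.comp (by fun_prop) fun v hv => ⟨le_min ht hv.1, min_le_left t v⟩
    · have h := intervalIntegral.continuousOn_primitive_interval'
        (hr.intervalIntegrable_field ht hτ1) left_mem_uIcc
      rwa [uIcc_of_le hτ1] at h
  have hIcc : Icc 0 (τ + 1) ∈ 𝓝[Ici 0] τ := by
    rw [← Ici_inter_Iic]
    exact inter_mem_nhdsWithin _ (Iic_mem_nhds (by linarith))
  exact (hcont τ ⟨hτ, by linarith⟩).mono_of_mem_nhdsWithin hIcc

lemma hasDerivWithinAt_integral_field (hr : IsAverageResolvent a b r) {t τ : ℝ} (ht : 0 ≤ t)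
    (hτ : 0 ≤ τ) :
    HasDerivWithinAt (fun τ => ∫ v in (0 : ℝ)..τ, (a * crossCorrelation r t v +
        b / (1 + v) * ∫ u in (0 : ℝ)..v, crossCorrelation r t u))
      (a * crossCorrelation r t τ + b / (1 + τ) * ∫ u in (0 : ℝ)..τ, crossCorrelation r t u)
      (Ici 0) τ := by
  refine hasDerivWithinAt_integral_Ici
    (f := fun v => a * crossCorrelation r t v +
      b / (1 + v) * ∫ u in (0 : ℝ)..v, crossCorrelation r t u) ?_ hτ
  refine (continuousOn_const.mul (hr.continuousOn_crossCorrelation ht)).add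
    ((continuousOn_const.div (by fun_prop) fun v hv => ?_).mul
      (intervalIntegral.continuous_primitive
        (hr.intervalIntegrable_crossCorrelation ht) 0).continuousOn)
  have : 0 ≤ v := hv
  linarith

lemma hasDerivWithinAt_crossCorrelation_Ici (hr : IsAverageResolvent a b r) {t τ : ℝ}
    (ht : 0 ≤ t) (hτ : t ≤ τ) :
    HasDerivWithinAt (crossCorrelation r t)
      (a * crossCorrelation r t τ + b / (1 + τ) * ∫ u in (0 : ℝ)..τ, crossCorrelation r t u)
      (Ici t) τ := by
  have heq : ∀ v ∈ Ici t, crossCorrelation r t v = (∫ s in (0 : ℝ)..t, r t s) +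
      ∫ v in (0 : ℝ)..v, (a * crossCorrelation r t v +
        b / (1 + v) * ∫ u in (0 : ℝ)..v, crossCorrelation r t u) := fun v hv => by
    have hv : t ≤ v := hv
    rw [hr.crossCorrelation_eq ht (ht.trans hv), min_eq_left hv]
  exact (((hr.hasDerivWithinAt_integral_field ht (ht.trans hτ)).mono
    (Ici_subset_Ici.2 ht)).const_add _).congr heq (heq τ hτ)

lemma hasDerivWithinAt_crossCorrelation_Icc (hr : IsAverageResolvent a b r) {t τ : ℝ}
    (ht : 0 ≤ t) (hτ : τ ∈ Icc 0 t) :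
    HasDerivWithinAt (crossCorrelation r t)
      (r t τ + (a * crossCorrelation r t τ +
        b / (1 + τ) * ∫ u in (0 : ℝ)..τ, crossCorrelation r t u))
      (Icc 0 t) τ := by
  have heq : ∀ v ∈ Icc 0 t, crossCorrelation r t v = (∫ s in (0 : ℝ)..v, r t s) +
      ∫ v in (0 : ℝ)..v, (a * crossCorrelation r t v +
        b / (1 + v) * ∫ u in (0 : ℝ)..v, crossCorrelation r t u) := fun v hv => by
    rw [hr.crossCorrelation_eq ht hv.1, min_eq_right hv.2]
  have : Fact (τ ∈ Icc 0 t) := ⟨hτ⟩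
  have h := intervalIntegral.integral_hasDerivWithinAt_right (s := Icc 0 t) (t := Icc 0 t)
    (((hr.continuousOn_snd t).mono (by
      rw [uIcc_of_le hτ.1]
      exact Icc_subset_Icc_right hτ.2)).intervalIntegrable (a := 0) (b := τ))
    ((hr.continuousOn_snd t).stronglyMeasurableAtFilter_nhdsWithin measurableSet_Icc τ)
    (hr.continuousOn_snd t τ hτ)
  exact (h.add ((hr.hasDerivWithinAt_integral_field ht hτ.1).mono
    Icc_subset_Ici_self)).congr heq (heq τ hτ)

lemma crossCorrelation_eq_integral (hr : IsAverageResolvent a b r) {t τ : ℝ} (ht : 0 ≤ t)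
    (hτ : 0 ≤ τ) : crossCorrelation r t τ = ∫ s in (0 : ℝ)..t, r t s * r τ s :=
  intervalIntegral.integral_congr fun s hs => by
    rw [uIcc_of_le ht] at hs
    simp only [hr.causalKernel_eq hs.1 ht, hr.causalKernel_eq hs.1 hτ]

/-- Transfer of a derivative of the cross-correlation to the lag variable. -/
lemma hasDerivWithinAt_autocovariance (hr : IsAverageResolvent a b r) (σ : ℝ) {t Δ d : ℝ}
    (ht : 0 ≤ t) {S S' : Set ℝ} (hS : MapsTo (t + ·) S S') (hS' : S' ⊆ Ici 0) (hΔ : Δ ∈ S)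
    (h : HasDerivWithinAt (crossCorrelation r t) d S' (t + Δ)) :
    HasDerivWithinAt (fun Δ' => σ ^ 2 * ∫ s in (0 : ℝ)..t, r t s * r (t + Δ') s)
      (σ ^ 2 * d) S Δ := by
  have heq : ∀ x ∈ S, σ ^ 2 * ∫ s in (0 : ℝ)..t, r t s * r (t + x) s =
      σ ^ 2 * crossCorrelation r t (t + x) := fun x hx => by
    rw [hr.crossCorrelation_eq_integral ht (hS' (hS hx))]
  have h' := (h.comp Δ ((hasDerivWithinAt_id Δ S).const_add t) hS).const_mul (σ ^ 2)
  rw [mul_one] at h'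
  exact h'.congr heq (heq Δ hΔ)

lemma integral_autocovariance (hr : IsAverageResolvent a b r) (σ : ℝ) {t Δ : ℝ} (ht : 0 ≤ t)
    (hΔ : -t ≤ Δ) :
    ∫ w in (-t)..Δ, σ ^ 2 * ∫ s in (0 : ℝ)..t, r t s * r (t + w) s =
      σ ^ 2 * ∫ u in (0 : ℝ)..(t + Δ), crossCorrelation r t u := by
  have h : ∫ w in (-t)..Δ, crossCorrelation r t (t + w) =
      ∫ u in (0 : ℝ)..(t + Δ), crossCorrelation r t u := by
    rw [intervalIntegral.integral_comp_add_left (crossCorrelation r t) t, add_neg_cancel]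
  rw [intervalIntegral.integral_const_mul, ← h]
  congr 1
  refine intervalIntegral.integral_congr fun w hw => ?_
  rw [uIcc_of_le hΔ] at hw
  exact (hr.crossCorrelation_eq_integral ht (by linarith [hw.1])).symm

end IsAverageResolvent

theorem resolvent_autocovariance_ode (a b σ : ℝ) (hσ : 0 < σ) (r : ℝ → ℝ → ℝ)
    (hzero : ∀ s : ℝ, 0 ≤ s → ∀ t : ℝ, 0 ≤ t → t < s → r t s = 0)
    (hone : ∀ s : ℝ, 0 ≤ s → r s s = 1)
    (hderivcont : ∀ s : ℝ, 0 ≤ s → ContinuousOn (fun t => a * r t s + b / (1 + t) * ∫ u in s..t, r u s) (Set.Ici s))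
    (hderiv : ∀ s : ℝ, 0 ≤ s → ∀ t : ℝ, s ≤ t →
      HasDerivWithinAt (fun τ => r τ s)
        (a * r t s + b / (1 + t) * ∫ u in s..t, r u s) (Set.Ici s) t)
    (t : ℝ) (ht : 0 ≤ t) :
    (∀ Δ : ℝ, 0 ≤ Δ →
      HasDerivWithinAt (fun Δ' : ℝ => σ ^ 2 * ∫ s in (0:ℝ)..t, r t s * r (t + Δ') s)
        (a * (σ ^ 2 * ∫ s in (0:ℝ)..t, r t s * r (t + Δ) s)
          + b / (1 + t + Δ) *
            ∫ w in (-t)..Δ, σ ^ 2 * ∫ s in (0:ℝ)..t, r t s * r (t + w) s)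
        (Set.Ici (0 : ℝ)) Δ) ∧
    (∀ Δ : ℝ, -t ≤ Δ → Δ < 0 →
      HasDerivWithinAt (fun Δ' : ℝ => σ ^ 2 * ∫ s in (0:ℝ)..t, r t s * r (t + Δ') s)
        (a * (σ ^ 2 * ∫ s in (0:ℝ)..t, r t s * r (t + Δ) s)
          + b / (1 + t + Δ) *
            (∫ w in (-t)..Δ, σ ^ 2 * ∫ s in (0:ℝ)..t, r t s * r (t + w) s)
          + σ ^ 2 * r t (t + Δ))
        (Set.Icc (-t) 0) Δ) := by
  have hr : IsAverageResolvent a b r := ⟨hzero, hone, hderiv⟩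
  refine ⟨fun Δ hΔ => ?_, fun Δ hΔ hΔ' => ?_⟩
  · have hmaps : MapsTo (t + ·) (Ici 0) (Ici t) := fun x hx => by
      simpa using hx
    have h := hr.hasDerivWithinAt_autocovariance σ ht hmaps (Ici_subset_Ici.2 ht) hΔ
      (hr.hasDerivWithinAt_crossCorrelation_Ici ht (hmaps hΔ))
    rw [hr.integral_autocovariance σ ht (by linarith),
      ← hr.crossCorrelation_eq_integral ht (add_nonneg ht hΔ), add_assoc 1 t Δ]
    exact h.congr_deriv (by ring)
  · have hmaps : MapsTo (t + ·) (Icc (-t) 0) (Icc 0 t) := fun x hx =>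
      ⟨by linarith [hx.1], by linarith [hx.2]⟩
    have hmem : Δ ∈ Icc (-t) 0 := ⟨hΔ, hΔ'.le⟩
    have h := hr.hasDerivWithinAt_autocovariance σ ht hmaps Icc_subset_Ici_self hmem
      (hr.hasDerivWithinAt_crossCorrelation_Icc ht (hmaps hmem))
    rw [hr.integral_autocovariance σ ht hΔ,
      ← hr.crossCorrelation_eq_integral ht (by linarith), add_assoc 1 t Δ]
    exact h.congr_deriv (by ring)
end
end
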